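/- Fix β ∈ (1, 10/9] and positive integers n ≥ 2, p, λ with m = pλ. Let 𝒯 be a finite subset of {x ∈ ℝ^n : ‖x‖₁ ≤ 1}, fix α ∈ (0,1), ρ ∈ (0,1), ν > 0, and an integer k ≥ 40(log(8|𝒯|) + ν). Then there exist constants C₁, C₂ > 0 depending only on β such that if m ≥ p ≥ C₁·k·log⁴(n)/(α²ρ²), then with probability at least 1 − ρ − e^{−ν} over the draw of Φ and D_ε, the map f : 𝒯 → {±1}^m defined by f(x) = Q_β((8/9)·Φ D_ε x) satisfies, for all x, x̃ ∈ 𝒯: | ‖Ṽ_β(f(x) − f(x̃))‖₂ − ‖x − x̃‖₂ | ≤ α·‖x − x̃‖₂ + C₂·β^{−λ+1}. -/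

import Mathlib

open scoped BigOperators Matrix
noncomputable section

/-- The sign `±1` associated with a boolean. -/
def rsign (b : Bool) : ℝ := if b then 1 else -1

/-- `ℓ¹` norm of a real vector. -/
def norm1 {n : ℕ} (x : Fin n → ℝ) : ℝ := ∑ j, |x j|

/-- Euclidean norm of a real vector. -/
def norm2 {n : ℕ} (x : Fin n → ℝ) : ℝ := Real.sqrt (∑ j, (x j) ^ 2)

/-- Block-diagonal matrix `I_p ⊗ v` with `p` copies of the row vector `v` on the diagonal. -/
def kronRow (p : ℕ) {lam : ℕ} (v : Fin lam → ℝ) : Matrix (Fin p) (Fin (p * lam)) ℝ :=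
  Matrix.of fun i j =>
    if (j : ℕ) / lam = (i : ℕ) then
      (if h2 : (j : ℕ) % lam < lam then v ⟨(j : ℕ) % lam, h2⟩ else 0)
    else 0

/-- The vector `v_β = (β^{-1}, …, β^{-λ})`. -/
def betaVec (β : ℝ) (lam : ℕ) : Fin lam → ℝ := fun j => β ^ (-((j : ℕ) : ℤ) - 1)

/-- The sign function used by the quantizer: `1` if `t ≥ 0`, `-1` otherwise. -/
def qsgn (t : ℝ) : ℝ := if 0 ≤ t then 1 else -1

/-- The state sequence of the one-bit distributed noise-shaping quantizer within a block:
`u_0 = 0`, `w_{s+1} = y_{s+1} + β u_s`, `u_{s+1} = w_{s+1} − sign(w_{s+1})`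
(the input is 0-indexed: `y s` is the `(s+1)`-st entry). -/
def nsU (β : ℝ) (y : ℕ → ℝ) : ℕ → ℝ
  | 0 => 0
  | s + 1 => (y s + β * nsU β y s) - qsgn (y s + β * nsU β y s)

/-- The one-bit distributed noise-shaping quantizer `Q_β : ℝ^{pλ} → {±1}^{pλ}` acting
independently on each of the `p` consecutive blocks of length `λ`. -/
def Qbeta (β : ℝ) (p lam : ℕ) (y : Fin (p * lam) → ℝ) : Fin (p * lam) → ℝ :=
  fun j =>
    let yb : ℕ → ℝ := fun s =>
      if h : ((j : ℕ) / lam) * lam + s < p * lam then y ⟨((j : ℕ) / lam) * lam + s, h⟩ else 0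
    qsgn (yb ((j : ℕ) % lam) + β * nsU β yb ((j : ℕ) % lam))

/-- Probability of an event under the uniform distribution on a finite sample space. -/
def unifProb {Ω : Type*} [Fintype Ω] (P : Ω → Prop) : ℝ :=
  (Nat.card {ω : Ω // P ω} : ℝ) / (Fintype.card Ω : ℝ)

/-- Hoeffding's bound for the moment generating function of a Rademacher sum. -/
lemma expect_exp_rademacher_le {ι : Type*} [Fintype ι] [DecidableEq ι] (c : ι → ℝ) :
    𝔼 σ : ι → Bool, Real.exp (∑ i, rsign (σ i) * c i) ≤ Real.exp ((∑ i, c i ^ 2) / 2) := by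
  have h1 : ∑ σ : ι → Bool, Real.exp (∑ i, rsign (σ i) * c i)
      = ∏ i, ∑ b : Bool, Real.exp (rsign b * c i) := by
    rw [Finset.prod_univ_sum, Fintype.piFinset_univ]
    exact Finset.sum_congr rfl fun σ _ => Real.exp_sum _ _
  have h2 : ∏ i, ∑ b : Bool, Real.exp (rsign b * c i)
      = 2 ^ Fintype.card ι * ∏ i, Real.cosh (c i) := by
    rw [← Finset.card_univ, ← Finset.prod_const, ← Finset.prod_mul_distrib]
    refine Finset.prod_congr rfl fun i _ => ?_
    rw [Real.cosh_eq]
    simp [rsign]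
    ring
  rw [Fintype.expect_eq_sum_div_card, h1, h2]
  simp only [Fintype.card_pi, Fintype.card_bool, Finset.prod_const, Finset.card_univ]
  push_cast
  rw [mul_div_cancel_left₀ _ (by positivity), Finset.sum_div, Real.exp_sum]
  exact Finset.prod_le_prod (fun i _ => (Real.cosh_pos _).le)
    fun i _ => Real.cosh_le_exp_half_sq _

/-- Expected maximum of a finite family of Rademacher sums, in terms of a dominating function. -/
lemma exists_dominating_rademacher {ι : Type*} [Fintype ι] [DecidableEq ι]
    (P : Finset (ι → ℝ)) {V Λ : ℝ} (hV : 0 < V) (hΛ : 0 < Λ)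
    (hP : ∀ c ∈ P, ∑ i, c i ^ 2 ≤ V ^ 2) (hcard : 2 * (P.card : ℝ) ≤ Real.exp Λ) :
    ∃ H : (ι → Bool) → ℝ, (∀ σ, 0 ≤ H σ) ∧
      (∀ σ, ∀ c ∈ P, |∑ i, rsign (σ i) * c i| ≤ H σ) ∧
      𝔼 σ, H σ ≤ V * Real.sqrt (2 * Λ) := by
  set θ := Real.sqrt (2 * Λ) / V with hθ
  have hs : 0 < Real.sqrt (2 * Λ) := Real.sqrt_pos.2 (by positivity)
  have hθ0 : 0 < θ := by positivity
  have hθV : θ ^ 2 * V ^ 2 = 2 * Λ := by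
    rw [hθ, div_pow, Real.sq_sqrt (by positivity)]; field_simp
  let S : (ι → Bool) → ℝ := fun σ => ∑ c ∈ P,
    (Real.exp (∑ i, rsign (σ i) * (θ * c i)) + Real.exp (∑ i, rsign (σ i) * (-θ * c i)))
  have hS0 : ∀ σ, 0 ≤ S σ := fun σ => Finset.sum_nonneg fun c _ => by positivity
  have hE : 𝔼 σ, S σ ≤ Real.exp (2 * Λ) := by
    have h1 : 𝔼 σ, S σ ≤ ∑ c ∈ P, (2 * Real.exp Λ) := by
      simp only [S]
      rw [Finset.expect_sum_comm]
      refine Finset.sum_le_sum fun c hc => ?_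
      rw [Finset.expect_add_distrib]
      have hb : ∀ t : ℝ, t ^ 2 = θ ^ 2 →
          𝔼 σ : ι → Bool, Real.exp (∑ i, rsign (σ i) * (t * c i)) ≤ Real.exp Λ := by
        intro t ht
        refine (expect_exp_rademacher_le _).trans (Real.exp_le_exp.2 ?_)
        simp only [mul_pow, ht]
        rw [← Finset.mul_sum]
        nlinarith [hP c hc, sq_nonneg θ]
      have := hb θ rfl
      have := hb (-θ) (by ring)
      linarith
    refine h1.trans ?_
    rw [Finset.sum_const, nsmul_eq_mul, two_mul Λ, Real.exp_add]
    nlinarith [Real.exp_pos Λ]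
  have hexp0 : Real.exp (-(2 * Λ)) * Real.exp (2 * Λ) = 1 := by
    rw [← Real.exp_add]; simp
  have key : ∀ σ, ∀ c ∈ P, θ * |∑ i, rsign (σ i) * c i|
      ≤ 2 * Λ - 1 + Real.exp (-(2 * Λ)) * S σ := by
    intro σ c hc
    have h1 : Real.exp (θ * |∑ i, rsign (σ i) * c i|) ≤ S σ := by
      have hle : Real.exp (∑ i, rsign (σ i) * (θ * c i))
          + Real.exp (∑ i, rsign (σ i) * (-θ * c i)) ≤ S σ :=
        Finset.single_le_sum (f := fun c : ι → ℝ => Real.exp (∑ i, rsign (σ i) * (θ * c i))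
          + Real.exp (∑ i, rsign (σ i) * (-θ * c i))) (fun c _ => by positivity) hc
      have e1 : ∀ t : ℝ, ∑ i, rsign (σ i) * (t * c i) = t * ∑ i, rsign (σ i) * c i := by
        intro t
        rw [Finset.mul_sum]
        exact Finset.sum_congr rfl fun i _ => by ring
      rw [e1, e1] at hle
      rcases abs_cases (∑ i, rsign (σ i) * c i) with ⟨h, _⟩ | ⟨h, _⟩
      · rw [h]; linarith [Real.exp_pos (-θ * ∑ i, rsign (σ i) * c i)]
      · rw [h, mul_neg, ← neg_mul]; linarith [Real.exp_pos (θ * ∑ i, rsign (σ i) * c i)]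
    have h2 := Real.add_one_le_exp (θ * |∑ i, rsign (σ i) * c i| - 2 * Λ)
    rw [sub_eq_add_neg, Real.exp_add, mul_comm (Real.exp _)] at h2
    have h3 := mul_le_mul_of_nonneg_left h1 (Real.exp_pos (-(2 * Λ))).le
    linarith
  have dom : ∀ σ, ∀ c ∈ P, |∑ i, rsign (σ i) * c i|
      ≤ (2 * Λ - 1 + Real.exp (-(2 * Λ)) * S σ) / θ := fun σ c hc => by
    rw [le_div_iff₀ hθ0, mul_comm]
    exact key σ c hc
  rcases P.eq_empty_or_nonempty with hPe | ⟨c₀, hc₀⟩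
  · exact ⟨fun _ => 0, fun _ => le_rfl, fun σ c hc => by simp [hPe] at hc, by simp; positivity⟩
  refine ⟨_, fun σ => (abs_nonneg _).trans (dom σ c₀ hc₀), dom, ?_⟩
  rw [← Finset.expect_div, Finset.expect_add_distrib, Fintype.expect_const, ← Finset.mul_expect,
    div_le_iff₀ hθ0]
  have h1 : V * Real.sqrt (2 * Λ) * θ = 2 * Λ := by
    rw [hθ, mul_div_assoc', mul_assoc, Real.mul_self_sqrt (by positivity),
      mul_div_cancel_left₀ _ hV.ne']
  have h2 := mul_le_mul_of_nonneg_left hE (Real.exp_pos (-(2 * Λ))).le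
  linarith

lemma convexOn_cosh_univ : ConvexOn ℝ Set.univ Real.cosh := by
  have h : ConvexOn ℝ Set.univ (fun x : ℝ => Real.exp (-x)) := by
    simpa [Function.comp_def] using
      (convexOn_exp.comp_linearMap (-LinearMap.id : ℝ →ₗ[ℝ] ℝ))
  have h2 := (convexOn_exp.add h).smul (c := (1 / 2 : ℝ)) (by norm_num)
  refine h2.congr fun x _ => ?_
  simp [Real.cosh_eq]
  ring

lemma cosh_le_affine (θ y : ℝ) {ξ : ℝ} (hξ : |ξ| ≤ 2) :
    Real.cosh (θ * (y + ξ)) ≤ Real.cosh (θ * y) * Real.cosh (2 * θ)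
      + ξ * ((Real.cosh (θ * (y + 2)) - Real.cosh (θ * (y - 2))) / 4) := by
  obtain ⟨h1, h2⟩ := abs_le.1 hξ
  have h := convexOn_cosh_univ.2 (Set.mem_univ (θ * (y + 2))) (Set.mem_univ (θ * (y - 2)))
    (show 0 ≤ (2 + ξ) / 4 by linarith) (show 0 ≤ (2 - ξ) / 4 by linarith) (by ring)
  simp only [smul_eq_mul] at h
  have e : (2 + ξ) / 4 * (θ * (y + 2)) + (2 - ξ) / 4 * (θ * (y - 2)) = θ * (y + ξ) := by ring
  rw [e] at h
  have e1 : Real.cosh (θ * (y + 2)) + Real.cosh (θ * (y - 2))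
      = 2 * (Real.cosh (θ * y) * Real.cosh (2 * θ)) := by
    rw [show θ * (y + 2) = θ * y + 2 * θ by ring, show θ * (y - 2) = θ * y - 2 * θ by ring,
      Real.cosh_add, Real.cosh_sub]
    ring
  linarith

/-- One step of the derandomized Maurey sampling: some signed coordinate vector (or zero)
does not increase the exponential potential by more than `exp (2 θ²)`. -/
lemma exists_maurey_step {n : ℕ} (hn : 0 < n) (U : Matrix (Fin n) (Fin n) ℝ)
    (hU : ∀ i j, |U i j| ≤ 1) (a : Fin n → ℝ) (ha : ∑ j, |a j| ≤ 1) (θ : ℝ) (y : Fin n → ℝ) :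
    ∃ q : Fin n × SignType,
      ∑ i, Real.cosh (θ * (y i + ((q.2 : ℝ) * U i q.1 - ∑ j, U i j * a j)))
        ≤ Real.exp (2 * θ ^ 2) * ∑ i, Real.cosh (θ * y i) := by
  set m : Fin n → ℝ := fun i => ∑ j, U i j * a j with hm
  have hm1 : ∀ i, |m i| ≤ 1 := fun i => by
    refine (Finset.abs_sum_le_sum_abs _ _).trans (le_trans (Finset.sum_le_sum fun j _ => ?_) ha)
    rw [abs_mul]
    exact mul_le_of_le_one_left (abs_nonneg _) (hU i j)
  set A : Fin n → ℝ := fun i => Real.cosh (θ * y i) * Real.cosh (2 * θ) with hA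
  set B : Fin n → ℝ := fun i =>
    (Real.cosh (θ * (y i + 2)) - Real.cosh (θ * (y i - 2))) / 4 with hB
  have hstep : ∀ (q : Fin n × SignType) (i : Fin n),
      Real.cosh (θ * (y i + ((q.2 : ℝ) * U i q.1 - m i)))
        ≤ A i + ((q.2 : ℝ) * U i q.1 - m i) * B i := by
    intro q i
    refine cosh_le_affine θ (y i) ?_
    have h1 : |(q.2 : ℝ) * U i q.1| ≤ 1 := by
      rw [abs_mul]
      have : |((q.2 : SignType) : ℝ)| ≤ 1 := by cases q.2 <;> simp
      exact mul_le_one₀ this (abs_nonneg _) (hU i _)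
    linarith [abs_sub (((q.2 : SignType) : ℝ) * U i q.1) (m i), hm1 i]
  have hAle : ∑ i, A i ≤ Real.exp (2 * θ ^ 2) * ∑ i, Real.cosh (θ * y i) := by
    rw [Finset.mul_sum]
    refine Finset.sum_le_sum fun i _ => ?_
    simp only [hA]
    rw [mul_comm]
    refine mul_le_mul_of_nonneg_right ?_ (Real.cosh_pos _).le
    refine (Real.cosh_le_exp_half_sq _).trans (le_of_eq ?_)
    congr 1; ring
  by_contra! hcon
  have hlt : ∀ q : Fin n × SignType, 0 < ∑ i, ((q.2 : ℝ) * U i q.1 - m i) * B i := by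
    intro q
    have h1 := Finset.sum_le_sum fun i (_ : i ∈ Finset.univ) => hstep q i
    rw [Finset.sum_add_distrib] at h1
    linarith [hcon q]
  have hz : ∑ j, |a j| * ∑ i, (((SignType.sign (a j) : SignType) : ℝ) * U i j - m i) * B i
      + (1 - ∑ j, |a j|) * ∑ i, (((0 : SignType) : ℝ) * U i ⟨0, hn⟩ - m i) * B i = 0 := by
    have h1 : ∀ j, |a j| * ∑ i, (((SignType.sign (a j) : SignType) : ℝ) * U i j - m i) * B i
        = ∑ i, U i j * a j * B i - |a j| * ∑ i, m i * B i := by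
      intro j
      rw [Finset.mul_sum, Finset.mul_sum, ← Finset.sum_sub_distrib]
      refine Finset.sum_congr rfl fun i _ => ?_
      have := abs_mul_sign (a j)
      calc _ = (|a j| * ((SignType.sign (a j) : SignType) : ℝ)) * U i j * B i
            - |a j| * (m i * B i) := by ring
        _ = _ := by rw [this]; ring
    rw [Finset.sum_congr rfl fun j _ => h1 j, Finset.sum_sub_distrib, Finset.sum_comm,
      ← Finset.sum_mul]
    have h2 : ∑ i, ∑ j, U i j * a j * B i = ∑ i, m i * B i :=
      Finset.sum_congr rfl fun i _ => by rw [hm, Finset.sum_mul]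
    rw [h2]
    simp
    ring
  have hnn : ∀ j ∈ Finset.univ, 0 ≤
      |a j| * ∑ i, (((SignType.sign (a j) : SignType) : ℝ) * U i j - m i) * B i :=
    fun j _ => mul_nonneg (abs_nonneg _) (hlt (j, SignType.sign (a j))).le
  have h0 := hlt (⟨0, hn⟩, 0)
  rcases ha.lt_or_eq with h | h
  · have := Finset.sum_nonneg hnn
    nlinarith
  · rw [h, sub_self, zero_mul, add_zero] at hz
    have h3 := (Finset.sum_eq_zero_iff_of_nonneg hnn).1 hz
    have h4 : ∀ j, |a j| = 0 := fun j => by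
      rcases mul_eq_zero.1 (h3 j (Finset.mem_univ j)) with h5 | h5
      · exact h5
      · exact absurd h5 (hlt (j, SignType.sign (a j))).ne'
    simp [h4] at h

lemma exists_maurey_potential {n : ℕ} (hn : 0 < n) (U : Matrix (Fin n) (Fin n) ℝ)
    (hU : ∀ i j, |U i j| ≤ 1) (a : Fin n → ℝ) (ha : ∑ j, |a j| ≤ 1) (θ : ℝ) (s : ℕ) :
    ∃ q : Fin s → Fin n × SignType,
      ∑ i, Real.cosh (θ * ((∑ t, ((q t).2 : ℝ) * U i (q t).1) - s * ∑ j, U i j * a j))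
        ≤ Real.exp (2 * s * θ ^ 2) * n := by
  induction s with
  | zero => exact ⟨fun _ => (⟨0, hn⟩, 0), by simp⟩
  | succ s ih =>
    obtain ⟨q, hq⟩ := ih
    obtain ⟨q', hq'⟩ := exists_maurey_step hn U hU a ha θ
      (fun i => (∑ t, ((q t).2 : ℝ) * U i (q t).1) - s * ∑ j, U i j * a j)
    refine ⟨Fin.cons q' q, ?_⟩
    have e : ∀ i, (∑ t, (((Fin.cons q' q : Fin (s + 1) → Fin n × SignType) t).2 : ℝ)
          * U i ((Fin.cons q' q : Fin (s + 1) → Fin n × SignType) t).1)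
          - ((s + 1 : ℕ) : ℝ) * ∑ j, U i j * a j
        = ((∑ t, ((q t).2 : ℝ) * U i (q t).1) - s * ∑ j, U i j * a j)
          + ((q'.2 : ℝ) * U i q'.1 - ∑ j, U i j * a j) := by
      intro i
      rw [Fin.sum_univ_succ]
      simp only [Fin.cons_zero, Fin.cons_succ]
      push_cast
      ring
    simp only [e]
    refine hq'.trans ((mul_le_mul_of_nonneg_left hq (Real.exp_pos _).le).trans (le_of_eq ?_))
    rw [← mul_assoc, ← Real.exp_add]
    congr 2
    push_cast
    ring

/-- Maurey's empirical method in the norm `max_i |⟨u_i, ·⟩|`. -/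
lemma exists_maurey {n : ℕ} (hn : 0 < n) (U : Matrix (Fin n) (Fin n) ℝ)
    (hU : ∀ i j, |U i j| ≤ 1) (a : Fin n → ℝ) {S : ℝ} (hS : 0 < S) (ha : ∑ j, |a j| ≤ S)
    {s : ℕ} (hs : 0 < s) :
    ∃ q : Fin s → Fin n × SignType, ∀ i,
      |(∑ j, U i j * a j) - S / s * ∑ t, ((q t).2 : ℝ) * U i (q t).1|
        ≤ S * Real.sqrt (8 * Real.log (2 * n) / s) := by
  have hs' : (0 : ℝ) < s := by exact_mod_cast hs
  have hn1 : (1 : ℝ) ≤ n := by exact_mod_cast hn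
  have hlog : 0 < Real.log (2 * n) := Real.log_pos (by linarith)
  set θ := Real.sqrt (Real.log (2 * n) / (2 * s)) with hθ
  have hθ0 : 0 < θ := Real.sqrt_pos.2 (by positivity)
  have hθ2 : θ ^ 2 = Real.log (2 * n) / (2 * s) := Real.sq_sqrt (by positivity)
  have ha' : ∑ j, |a j / S| ≤ 1 := by
    simp only [abs_div, abs_of_pos hS]
    rw [← Finset.sum_div, div_le_one hS]
    exact ha
  obtain ⟨q, hq⟩ := exists_maurey_potential hn U hU (fun j => a j / S) ha' θ s
  refine ⟨q, fun i => ?_⟩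
  set d := (∑ t, ((q t).2 : ℝ) * U i (q t).1) - s * ∑ j, U i j * (a j / S) with hd
  have h1 : Real.cosh (θ * d) ≤ Real.exp (2 * s * θ ^ 2) * n :=
    (Finset.single_le_sum (f := fun i => Real.cosh (θ * ((∑ t, ((q t).2 : ℝ) * U i (q t).1)
      - s * ∑ j, U i j * (a j / S)))) (fun i _ => (Real.cosh_pos _).le)
      (Finset.mem_univ i)).trans hq
  have h2 : Real.exp (θ * |d|) ≤ 2 * Real.cosh (θ * d) := by
    rw [← Real.cosh_abs, abs_mul, abs_of_pos hθ0, Real.cosh_eq]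
    linarith [Real.exp_pos (-(θ * |d|))]
  have h3 : Real.exp (θ * |d|) ≤ Real.exp (2 * Real.log (2 * n)) := by
    have e : 2 * s * θ ^ 2 = Real.log (2 * n) := by rw [hθ2]; field_simp
    rw [e] at h1
    rw [two_mul (Real.log _), Real.exp_add]
    nth_rewrite 2 [Real.exp_log (by positivity)]
    linarith
  have h4 : θ * |d| ≤ 2 * Real.log (2 * n) := Real.exp_le_exp.1 h3
  have h5 : |d| ≤ s * Real.sqrt (8 * Real.log (2 * n) / s) := by
    have e : 2 * Real.log (2 * n) = θ * (s * Real.sqrt (8 * Real.log (2 * n) / s)) := by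
      have : θ * Real.sqrt (8 * Real.log (2 * n) / s) = 2 * Real.log (2 * n) / s := by
        rw [hθ, ← Real.sqrt_mul (by positivity), show Real.log (2 * n) / (2 * s) *
          (8 * Real.log (2 * n) / s) = (2 * Real.log (2 * n) / s) ^ 2 by field_simp; ring]
        exact Real.sqrt_sq (by positivity)
      rw [mul_left_comm, this]; field_simp
    rw [e] at h4
    exact le_of_mul_le_mul_left h4 hθ0
  have h6 : (∑ j, U i j * a j) - S / s * ∑ t, ((q t).2 : ℝ) * U i (q t).1 = -(S / s) * d := by
    rw [hd]
    have : ∑ j, U i j * (a j / S) = (∑ j, U i j * a j) / S := by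
      rw [Finset.sum_div]; exact Finset.sum_congr rfl fun j _ => by ring
    rw [this]; field_simp; ring
  rw [h6, abs_mul, abs_neg, abs_of_pos (by positivity)]
  calc S / s * |d| ≤ S / s * (s * Real.sqrt (8 * Real.log (2 * n) / s)) := by gcongr
    _ = _ := by field_simp

/-- The vertex of the cube `{±1}ⁿ` encoded by a boolean vector. -/
def cubeVertex {n : ℕ} (b : Fin n → Bool) : Fin n → ℝ := fun t => rsign (b t)

lemma exists_talagrand_weight {r : ℝ} (hr0 : 0 < r) (hr1 : r ≤ 1) :
    ∃ θ : ℝ, 0 ≤ θ ∧ θ ≤ 1 ∧ Real.exp ((1 - θ) ^ 2 / 18) * r ^ (-θ) ≤ 2 - r := by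
  set l := -Real.log r with hl
  have hl0 : 0 ≤ l := by rw [hl]; linarith [Real.log_nonpos hr0.le hr1]
  have hrl : r = Real.exp (-l) := by rw [hl, neg_neg, Real.exp_log hr0]
  have hpow : ∀ θ : ℝ, r ^ (-θ) = Real.exp (l * θ) := fun θ => by
    rw [Real.rpow_def_of_pos hr0, hl]; congr 1; ring
  rcases le_total l (1 / 3) with h | h
  · refine ⟨1 - 3 * l, by linarith, by linarith, ?_⟩
    rw [hpow, ← Real.exp_add]
    have e : (1 - (1 - 3 * l)) ^ 2 / 18 + l * (1 - 3 * l) = l - 5 / 2 * l ^ 2 := by ring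
    rw [e]
    have hw0 : 0 ≤ l - 5 / 2 * l ^ 2 := by nlinarith
    have hw1 : l - 5 / 2 * l ^ 2 ≤ l := by nlinarith
    have h1 := (abs_le.1 (Real.abs_exp_sub_one_sub_id_le (x := l - 5 / 2 * l ^ 2)
      (by rw [abs_of_nonneg hw0]; linarith))).2
    have h2 := (abs_le.1 (Real.abs_exp_sub_one_sub_id_le (x := -l)
      (by rw [abs_neg, abs_of_nonneg hl0]; linarith))).2
    have h3 : (l - 5 / 2 * l ^ 2) ^ 2 ≤ l ^ 2 := by gcongr
    rw [hrl]
    nlinarith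
  · refine ⟨0, le_rfl, zero_le_one, ?_⟩
    rw [hpow]
    have h1 := (abs_le.1 (Real.abs_exp_sub_one_sub_id_le (x := (1 - 0) ^ 2 / 18)
      (by norm_num [abs_of_pos]))).2
    have h2 := (abs_le.1 (Real.abs_exp_sub_one_sub_id_le (x := -(1 / 3))
      (by norm_num [abs_of_pos]))).2
    have h3 : r ≤ Real.exp (-(1 / 3)) := by rw [hrl]; exact Real.exp_le_exp.2 (by linarith)
    simp only [mul_zero, Real.exp_zero, mul_one]
    norm_num at h1 h2 h3 ⊢
    linarith

/-- Hölder's inequality for a weighted geometric mean of two exponentials. -/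
lemma sum_exp_convex_comb_le {ι : Type*} (s : Finset ι) (f g : ι → ℝ) {θ F G : ℝ}
    (hθ0 : 0 ≤ θ) (hθ1 : θ ≤ 1) (hF0 : 0 < F) (hG0 : 0 < G)
    (hF : ∑ i ∈ s, Real.exp (f i) ≤ F) (hG : ∑ i ∈ s, Real.exp (g i) ≤ G) :
    ∑ i ∈ s, Real.exp (θ * f i + (1 - θ) * g i) ≤ F ^ θ * G ^ (1 - θ) := by
  have hpt : ∀ i, Real.exp (θ * f i + (1 - θ) * g i)
      ≤ F ^ θ * G ^ (1 - θ) * (θ * (Real.exp (f i) / F) + (1 - θ) * (Real.exp (g i) / G)) := by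
    intro i
    have h := Real.geom_mean_le_arith_mean2_weighted hθ0 (sub_nonneg.2 hθ1)
      (div_pos (Real.exp_pos (f i)) hF0).le (div_pos (Real.exp_pos (g i)) hG0).le (by ring)
    rw [Real.div_rpow (Real.exp_pos _).le hF0.le, Real.div_rpow (Real.exp_pos _).le hG0.le,
      ← Real.exp_mul, ← Real.exp_mul, div_mul_div_comm, ← Real.exp_add,
      div_le_iff₀ (by positivity)] at h
    rw [mul_comm θ, mul_comm (1 - θ), mul_comm (F ^ θ * G ^ (1 - θ))]
    exact h
  refine (Finset.sum_le_sum fun i _ => hpt i).trans ?_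
  rw [← Finset.mul_sum, Finset.sum_add_distrib, ← Finset.mul_sum, ← Finset.mul_sum,
    ← Finset.sum_div, ← Finset.sum_div]
  refine mul_le_of_le_one_right (by positivity) ?_
  have h1 : (∑ i ∈ s, Real.exp (f i)) / F ≤ 1 := (div_le_one hF0).2 hF
  have h2 : (∑ i ∈ s, Real.exp (g i)) / G ≤ 1 := (div_le_one hG0).2 hG
  nlinarith

lemma talagrand_combine {c c' S₁ S₂ N : ℝ} (hN : 0 ≤ N) (hc : 0 < c) (hc' : 0 ≤ c')
    (h₁ : S₁ ≤ N / c) (h₂ : S₂ ≤ N / c * (2 - c' / c)) : (c + c') * (S₁ + S₂) ≤ N * 4 := by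
  calc (c + c') * (S₁ + S₂) ≤ (c + c') * (N / c + N / c * (2 - c' / c)) := by gcongr
    _ = N * ((1 + c' / c) * (3 - c' / c)) := by field_simp; ring
    _ ≤ N * 4 := by gcongr; nlinarith [sq_nonneg (c' / c - 1)]

open Classical in
/-- Talagrand's convex distance inequality on the discrete cube, in terms of a selection of
points of the convex set. -/
lemma exists_talagrand_selection (n : ℕ) (A : Set (Fin n → ℝ)) (hA : Convex ℝ A)
    (hne : ∃ b : Fin n → Bool, cubeVertex b ∈ A) :
    ∃ r : (Fin n → Bool) → Fin n → ℝ, (∀ b, r b ∈ A) ∧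
      ((Finset.univ.filter fun b : Fin n → Bool => cubeVertex b ∈ A).card : ℝ)
        * ∑ b, Real.exp ((∑ t, (cubeVertex b t - r b t) ^ 2) / 72) ≤ 4 ^ n := by
  induction n with
  | zero =>
    obtain ⟨b, hb⟩ := hne
    refine ⟨fun _ => cubeVertex b, fun _ => hb, ?_⟩
    have : ((Finset.univ.filter fun b : Fin 0 → Bool => cubeVertex b ∈ A).card : ℝ) ≤ 1 := by
      exact_mod_cast (Finset.card_filter_le _ _).trans (by simp)
    simpa using this
  | succ n ih =>
    -- the sections of `A` over the two values of the first coordinate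
    let sec : Bool → Set (Fin n → ℝ) := fun s => {y | (Fin.cons (rsign s) y : Fin (n + 1) → ℝ) ∈ A}
    let cnt : Bool → ℝ := fun s =>
      ((Finset.univ.filter fun b : Fin n → Bool => cubeVertex b ∈ sec s).card : ℝ)
    have hcomb : ∀ (θ s t : ℝ) (y z : Fin n → ℝ),
        (θ • (Fin.cons s y : Fin (n + 1) → ℝ) + (1 - θ) • (Fin.cons t z : Fin (n + 1) → ℝ))
          = Fin.cons (θ * s + (1 - θ) * t) (θ • y + (1 - θ) • z) := by
      intro θ s t y z
      ext i
      refine Fin.cases ?_ (fun i => ?_) i <;> simp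
    have hsec : ∀ s, Convex ℝ (sec s) := by
      intro s y hy z hz a b ha hb hab
      have h := hA hy hz ha hb hab
      obtain rfl : b = 1 - a := by linarith
      rw [hcomb, ← add_mul, hab, one_mul] at h
      exact h
    have hvert : ∀ s (b : Fin n → Bool),
        (cubeVertex (Fin.cons s b : Fin (n + 1) → Bool)) = Fin.cons (rsign s) (cubeVertex b) := by
      intro s b
      ext i
      refine Fin.cases ?_ (fun i => ?_) i <;> simp [cubeVertex]
    have hsplit : ∀ f : (Fin (n + 1) → Bool) → ℝ, ∀ s : Bool,
        ∑ b, f b = ∑ b : Fin n → Bool, f (Fin.cons s b) + ∑ b : Fin n → Bool, f (Fin.cons (!s) b) := by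
      intro f s
      rw [← (Fin.consEquiv fun _ => Bool).sum_comp, Fintype.sum_prod_type]
      cases s <;> simp [Fin.consEquiv, add_comm]
    have hcnt : ∀ s, ((Finset.univ.filter fun b : Fin (n + 1) → Bool => cubeVertex b ∈ A).card : ℝ)
        = cnt s + cnt (!s) := by
      intro s
      simp only [cnt]
      rw [← Finset.sum_boole, hsplit _ s, ← Finset.sum_boole, ← Finset.sum_boole]
      simp only [hvert]
      rfl
    -- `s` is the direction with the larger section
    obtain ⟨s, hs⟩ : ∃ s, cnt (!s) ≤ cnt s := by
      rcases le_total (cnt true) (cnt false) with h | h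
      · exact ⟨false, h⟩
      · exact ⟨true, h⟩
    have hpos : 0 < cnt s := by
      obtain ⟨b, hb⟩ := hne
      have h1 : (0 : ℝ) < cnt s + cnt (!s) := by
        rw [← hcnt s]
        exact_mod_cast Finset.card_pos.2 ⟨b, by simpa using hb⟩
      linarith
    have hexists : ∀ s, 0 < cnt s → ∃ b : Fin n → Bool, cubeVertex b ∈ sec s := by
      intro s h
      obtain ⟨b, hb⟩ := Finset.card_pos.1 (Nat.cast_pos (α := ℝ).1 h)
      exact ⟨b, by simpa using hb⟩
    obtain ⟨r₁, hr₁, hS₁⟩ := ih (sec s) (hsec s) (hexists s hpos)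
    set S₁ := ∑ b, Real.exp ((∑ t, (cubeVertex b t - r₁ b t) ^ 2) / 72) with hS₁def
    have hS₁' : S₁ ≤ 4 ^ n / cnt s := by rw [le_div_iff₀ hpos, mul_comm]; exact hS₁
    have hrs : (rsign (!s) - rsign s) ^ 2 = 4 := by cases s <;> norm_num [rsign]
    -- it suffices to select points over the opposite section with a suitable bound
    suffices hmain : ∃ r₂ : (Fin n → Bool) → Fin (n + 1) → ℝ, (∀ b, r₂ b ∈ A) ∧
        ∑ b : Fin n → Bool, Real.exp ((∑ t, ((Fin.cons (rsign (!s)) (cubeVertex b) :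
          Fin (n + 1) → ℝ) t - r₂ b t) ^ 2) / 72)
          ≤ 4 ^ n / cnt s * (2 - cnt (!s) / cnt s) by
      obtain ⟨r₂, hr₂, hS₂⟩ := hmain
      refine ⟨fun b => if b 0 = s then Fin.cons (rsign s) (r₁ (Fin.tail b)) else r₂ (Fin.tail b),
        fun b => ?_, ?_⟩
      · dsimp only
        split_ifs
        · exact hr₁ _
        · exact hr₂ _
      · rw [hcnt s, hsplit _ s]
        simp only [hvert, Fin.cons_zero, if_true, Fin.tail_cons, Bool.not_eq_self, if_false]
        have e : ∀ b : Fin n → Bool, ∑ t, ((Fin.cons (rsign s) (cubeVertex b) :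
            Fin (n + 1) → ℝ) t - (Fin.cons (rsign s) (r₁ b) : Fin (n + 1) → ℝ) t) ^ 2
            = ∑ t, (cubeVertex b t - r₁ b t) ^ 2 := by
          intro b
          rw [Fin.sum_univ_succ]
          simp
        simp only [e]
        rw [← hS₁def]
        rw [pow_succ]
        exact talagrand_combine (by positivity) hpos (Nat.cast_nonneg _) hS₁' hS₂
    have hc0 : 0 ≤ cnt (!s) := Nat.cast_nonneg _
    rcases hc0.eq_or_lt with h0 | h0
    · refine ⟨fun b => Fin.cons (rsign s) (r₁ b), hr₁, ?_⟩
      have e : ∀ b : Fin n → Bool, Real.exp ((∑ t, ((Fin.cons (rsign (!s)) (cubeVertex b) :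
          Fin (n + 1) → ℝ) t - (Fin.cons (rsign s) (r₁ b) : Fin (n + 1) → ℝ) t) ^ 2) / 72)
          = Real.exp (4 / 72) * Real.exp ((∑ t, (cubeVertex b t - r₁ b t) ^ 2) / 72) := by
        intro b
        rw [Fin.sum_univ_succ]
        simp only [Fin.cons_zero, Fin.cons_succ]
        rw [hrs, add_div, Real.exp_add]
      simp only [e]
      rw [← Finset.mul_sum, ← hS₁def, ← h0, zero_div, sub_zero, mul_comm]
      have h1 := (abs_le.1 (Real.abs_exp_sub_one_sub_id_le (x := (4 / 72 : ℝ))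
        (by norm_num [abs_of_pos]))).2
      have : Real.exp (4 / 72) ≤ 2 := by norm_num at h1 ⊢; linarith
      have : 0 ≤ S₁ := Finset.sum_nonneg fun _ _ => (Real.exp_pos _).le
      gcongr
    · obtain ⟨r₃, hr₃, hS₃⟩ := ih (sec (!s)) (hsec _) (hexists _ h0)
      set S₃ := ∑ b, Real.exp ((∑ t, (cubeVertex b t - r₃ b t) ^ 2) / 72) with hS₃def
      have hS₃' : S₃ ≤ 4 ^ n / cnt (!s) := by rw [le_div_iff₀ h0, mul_comm]; exact hS₃
      obtain ⟨θ, hθ0, hθ1, hθ⟩ := exists_talagrand_weight (r := cnt (!s) / cnt s)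
        (by positivity) ((div_le_one hpos).2 hs)
      refine ⟨fun b => θ • (Fin.cons (rsign (!s)) (r₃ b) : Fin (n + 1) → ℝ)
        + (1 - θ) • (Fin.cons (rsign s) (r₁ b) : Fin (n + 1) → ℝ),
        fun b => hA (hr₃ b) (hr₁ b) hθ0 (sub_nonneg.2 hθ1) (by ring), ?_⟩
      have hpt : ∀ b : Fin n → Bool, Real.exp ((∑ t, ((Fin.cons (rsign (!s)) (cubeVertex b) :
          Fin (n + 1) → ℝ) t - (θ • (Fin.cons (rsign (!s)) (r₃ b) : Fin (n + 1) → ℝ)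
            + (1 - θ) • (Fin.cons (rsign s) (r₁ b) : Fin (n + 1) → ℝ)) t) ^ 2) / 72)
          ≤ Real.exp ((1 - θ) ^ 2 / 18) *
            Real.exp (θ * ((∑ t, (cubeVertex b t - r₃ b t) ^ 2) / 72)
              + (1 - θ) * ((∑ t, (cubeVertex b t - r₁ b t) ^ 2) / 72)) := by
        intro b
        rw [hcomb, ← Real.exp_add, Real.exp_le_exp, Fin.sum_univ_succ]
        simp only [Fin.cons_zero, Fin.cons_succ]
        have e1 : (rsign (!s) - (θ * rsign (!s) + (1 - θ) * rsign s)) ^ 2 = 4 * (1 - θ) ^ 2 := by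
          rw [← hrs]; ring
        have e2 : ∑ t, (cubeVertex b t - (θ • r₃ b + (1 - θ) • r₁ b) t) ^ 2
            ≤ θ * ∑ t, (cubeVertex b t - r₃ b t) ^ 2
              + (1 - θ) * ∑ t, (cubeVertex b t - r₁ b t) ^ 2 := by
          rw [Finset.mul_sum, Finset.mul_sum, ← Finset.sum_add_distrib]
          refine Finset.sum_le_sum fun t _ => ?_
          simp only [Pi.add_apply, Pi.smul_apply, smul_eq_mul]
          nlinarith [mul_nonneg (mul_nonneg hθ0 (sub_nonneg.2 hθ1)) (sq_nonneg (r₃ b t - r₁ b t))]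
        rw [e1]
        linarith
      refine (Finset.sum_le_sum fun b _ => hpt b).trans ?_
      rw [← Finset.mul_sum]
      have hH := sum_exp_convex_comb_le Finset.univ _ _ hθ0 hθ1 (by positivity) (by positivity)
        hS₃' hS₁'
      have e3 : (4 ^ n / cnt (!s)) ^ θ * (4 ^ n / cnt s) ^ (1 - θ)
          = 4 ^ n / cnt s * (cnt (!s) / cnt s) ^ (-θ) := by
        have h4 : (0 : ℝ) < 4 ^ n / cnt s := by positivity
        have h5 : (4 : ℝ) ^ n / cnt (!s) = 4 ^ n / cnt s * (cnt (!s) / cnt s)⁻¹ := by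
          field_simp
        rw [h5, Real.mul_rpow h4.le (by positivity), Real.inv_rpow (by positivity),
          ← Real.rpow_neg (by positivity), mul_right_comm, ← Real.rpow_add h4]
        simp
      rw [e3] at hH
      calc _ ≤ Real.exp ((1 - θ) ^ 2 / 18) * (4 ^ n / cnt s * (cnt (!s) / cnt s) ^ (-θ)) := by
            gcongr
        _ = 4 ^ n / cnt s * (Real.exp ((1 - θ) ^ 2 / 18) * (cnt (!s) / cnt s) ^ (-θ)) := by ring
        _ ≤ _ := by gcongr

open Classical in
lemma card_rademacher_tail_le {n : ℕ} (c : Fin n → ℝ) (hc : ∑ t, c t ^ 2 ≤ 1) {B : ℝ}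
    (hB : 0 ≤ B) :
    ((Finset.univ.filter fun b : Fin n → Bool => B < |∑ t, rsign (b t) * c t|).card : ℝ)
      ≤ 2 * Real.exp (-(B ^ 2 / 2)) * 2 ^ n := by
  have hE : ∀ θ : ℝ, θ ^ 2 = B ^ 2 →
      ∑ b : Fin n → Bool, Real.exp (θ * ∑ t, rsign (b t) * c t) ≤ Real.exp (B ^ 2 / 2) * 2 ^ n := by
    intro θ hθ
    have h := expect_exp_rademacher_le fun t => θ * c t
    rw [Fintype.expect_eq_sum_div_card, div_le_iff₀ (by positivity)] at h
    have e : ∀ b : Fin n → Bool, ∑ t, rsign (b t) * (θ * c t) = θ * ∑ t, rsign (b t) * c t := by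
      intro b
      rw [Finset.mul_sum]
      exact Finset.sum_congr rfl fun t _ => by ring
    simp only [e] at h
    refine h.trans ?_
    simp only [Fintype.card_pi, Fintype.card_bool, Finset.prod_const, Finset.card_univ,
      Fintype.card_fin, mul_pow, hθ]
    push_cast
    rw [← Finset.mul_sum]
    gcongr
    nlinarith [sq_nonneg B]
  have h1 : ((Finset.univ.filter fun b : Fin n → Bool => B < |∑ t, rsign (b t) * c t|).card : ℝ)
      * Real.exp (B ^ 2) ≤ 2 * (Real.exp (B ^ 2 / 2) * 2 ^ n) := by
    calc _ = ∑ b ∈ Finset.univ.filter fun b : Fin n → Bool => B < |∑ t, rsign (b t) * c t|,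
          Real.exp (B ^ 2) := by rw [Finset.sum_const, nsmul_eq_mul]
      _ ≤ ∑ b ∈ Finset.univ.filter fun b : Fin n → Bool => B < |∑ t, rsign (b t) * c t|,
          (Real.exp (B * ∑ t, rsign (b t) * c t) + Real.exp (-B * ∑ t, rsign (b t) * c t)) := by
        refine Finset.sum_le_sum fun b hb => ?_
        have hb' := (Finset.mem_filter.1 hb).2
        have h2 : Real.exp (B ^ 2) ≤ Real.exp (B * |∑ t, rsign (b t) * c t|) :=
          Real.exp_le_exp.2 (by nlinarith)
        rcases abs_cases (∑ t, rsign (b t) * c t) with ⟨h, _⟩ | ⟨h, _⟩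
        · rw [h] at h2; linarith [Real.exp_pos (-B * ∑ t, rsign (b t) * c t)]
        · rw [h, mul_neg, ← neg_mul] at h2
          linarith [Real.exp_pos (B * ∑ t, rsign (b t) * c t)]
      _ ≤ ∑ b : Fin n → Bool,
          (Real.exp (B * ∑ t, rsign (b t) * c t) + Real.exp (-B * ∑ t, rsign (b t) * c t)) :=
        Finset.sum_le_sum_of_subset_of_nonneg (Finset.filter_subset _ _)
          fun b _ _ => by positivity
      _ ≤ _ := by
        rw [Finset.sum_add_distrib]
        linarith [hE B rfl, hE (-B) (by ring)]
  rw [← le_div_iff₀ (Real.exp_pos _)] at h1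
  refine h1.trans (le_of_eq ?_)
  have e : Real.exp (-(B ^ 2 / 2)) = Real.exp (B ^ 2 / 2) / Real.exp (B ^ 2) := by
    rw [← Real.exp_sub]; congr 1; ring
  rw [e]; ring

/-- A vector is a sum of a part of `ℓ¹`-norm at most `√κ` and a part which is nearly
orthogonal to all the rows of `U`. -/
def Splits {n : ℕ} (U : Matrix (Fin n) (Fin n) ℝ) (κ B : ℝ) (z : Fin n → ℝ) : Prop :=
  ∃ a c : Fin n → ℝ, (∀ t, z t = a t + c t) ∧ (∑ t, |a t|) ^ 2 ≤ κ ∧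
    ∀ i, |∑ t, U i t * c t| ≤ B

open Classical in
/-- For most choices of signs, the sign-randomized vector splits. -/
lemma card_not_splits_le {n : ℕ} (hn : 0 < n) (U : Matrix (Fin n) (Fin n) ℝ)
    (hU : ∀ i j, |U i j| ≤ 1) (x : Fin n → ℝ) (hx : ∑ t, x t ^ 2 ≤ 1) (k : ℝ) :
    ((Finset.univ.filter fun b : Fin n → Bool =>
        ¬ Splits U (min (4 * k) n) (Real.sqrt (2 * Real.log (4 * n)))
          (fun t => rsign (b t) * x t)).card : ℝ)
      ≤ 2 * Real.exp (-(k / 18)) * 2 ^ n := by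
  have hn1 : (1 : ℝ) ≤ n := by exact_mod_cast hn
  have hlog : 0 ≤ Real.log (4 * n) := Real.log_nonneg (by linarith)
  set B := Real.sqrt (2 * Real.log (4 * n)) with hB
  have hB0 : 0 ≤ B := Real.sqrt_nonneg _
  have hB2 : B ^ 2 = 2 * Real.log (4 * n) := Real.sq_sqrt (by positivity)
  have hl1 : ∀ (w : Fin n → ℝ), (∑ t, |x t * w t|) ^ 2 ≤ ∑ t, w t ^ 2 := by
    intro w
    have h := Finset.sum_mul_sq_le_sq_mul_sq Finset.univ (fun t => |x t|) (fun t => |w t|)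
    simp only [sq_abs, ← abs_mul] at h
    refine h.trans (mul_le_of_le_one_left (Finset.sum_nonneg fun _ _ => sq_nonneg _) hx)
  have hcube : ∀ b : Fin n → Bool, ∑ t, rsign (b t) ^ 2 = n := by
    intro b
    have : ∀ b : Bool, rsign b ^ 2 = 1 := fun b => by cases b <;> simp [rsign]
    simp [this]
  rcases le_total (n : ℝ) (4 * k) with hk | hk
  · have : ∀ b : Fin n → Bool, Splits U (min (4 * k) n) B (fun t => rsign (b t) * x t) := by
      intro b
      refine ⟨fun t => x t * rsign (b t), fun _ => 0, fun t => by ring, ?_, by simp [hB0]⟩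
      rw [min_eq_right hk, ← hcube b]
      exact hl1 _
    simp only [this, not_true_eq_false, Finset.filter_false, Finset.card_empty, Nat.cast_zero]
    positivity
  rw [min_eq_left hk]
  let A : Set (Fin n → ℝ) := {e | ∀ i, |∑ t, U i t * (x t * e t)| ≤ B}
  have hA : Convex ℝ A := by
    intro e he f hf a b ha hb hab i
    have e1 : ∑ t, U i t * (x t * (a • e + b • f) t)
        = a * ∑ t, U i t * (x t * e t) + b * ∑ t, U i t * (x t * f t) := by
      rw [Finset.mul_sum, Finset.mul_sum, ← Finset.sum_add_distrib]
      refine Finset.sum_congr rfl fun t _ => ?_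
      simp only [Pi.add_apply, Pi.smul_apply, smul_eq_mul]
      ring
    rw [e1]
    calc _ ≤ a * |∑ t, U i t * (x t * e t)| + b * |∑ t, U i t * (x t * f t)| := by
          refine (abs_add_le _ _).trans (le_of_eq ?_)
          rw [abs_mul, abs_mul, abs_of_nonneg ha, abs_of_nonneg hb]
      _ ≤ a * B + b * B := by gcongr; exacts [he i, hf i]
      _ = B := by rw [← add_mul, hab, one_mul]
  have hcompl : ((Finset.univ.filter fun b : Fin n → Bool => ¬ cubeVertex b ∈ A).card : ℝ)
      ≤ 2 ^ n / 2 := by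
    have hsub : (Finset.univ.filter fun b : Fin n → Bool => ¬ cubeVertex b ∈ A)
        ⊆ Finset.univ.biUnion fun i : Fin n => Finset.univ.filter fun b : Fin n → Bool =>
          B < |∑ t, rsign (b t) * (U i t * x t)| := by
      intro b hb
      have hb' := (Finset.mem_filter.1 hb).2
      simp only [A, Set.mem_ofPred_eq, not_forall, not_le] at hb'
      obtain ⟨i, hi⟩ := hb'
      simp only [Finset.mem_biUnion, Finset.mem_univ, true_and, Finset.mem_filter]
      refine ⟨i, hi.trans_le (le_of_eq ?_)⟩
      congr 1
      exact Finset.sum_congr rfl fun t _ => by simp only [cubeVertex]; ring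
    have h1 := (Finset.card_le_card hsub).trans Finset.card_biUnion_le
    have h2 : ∀ i : Fin n, ((Finset.univ.filter fun b : Fin n → Bool =>
        B < |∑ t, rsign (b t) * (U i t * x t)|).card : ℝ) ≤ 2 ^ n / (2 * n) := by
      intro i
      refine (card_rademacher_tail_le (fun t => U i t * x t) ?_ hB0).trans (le_of_eq ?_)
      · refine le_trans (Finset.sum_le_sum fun t _ => ?_) hx
        rw [mul_pow]
        refine mul_le_of_le_one_left (sq_nonneg _) ?_
        rw [← sq_abs]
        exact pow_le_one₀ (abs_nonneg _) (hU i t)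
      · rw [hB2, mul_div_cancel_left₀ _ (two_ne_zero), Real.exp_neg, Real.exp_log (by positivity)]
        field_simp
        ring
    calc _ ≤ ∑ i : Fin n, ((Finset.univ.filter fun b : Fin n → Bool =>
          B < |∑ t, rsign (b t) * (U i t * x t)|).card : ℝ) := by exact_mod_cast h1
      _ ≤ ∑ i : Fin n, (2 : ℝ) ^ n / (2 * n) := Finset.sum_le_sum fun i _ => h2 i
      _ = _ := by
        rw [Finset.sum_const, Finset.card_univ, Fintype.card_fin, nsmul_eq_mul]
        field_simp
  have hcard : (2 : ℝ) ^ n / 2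
      ≤ ((Finset.univ.filter fun b : Fin n → Bool => cubeVertex b ∈ A).card : ℝ) := by
    have h := Finset.card_filter_add_card_filter_not (s := (Finset.univ : Finset (Fin n → Bool)))
      (fun b => cubeVertex b ∈ A)
    have h' : ((Finset.univ.filter fun b : Fin n → Bool => cubeVertex b ∈ A).card : ℝ)
      + ((Finset.univ.filter fun b : Fin n → Bool => ¬ cubeVertex b ∈ A).card : ℝ) = 2 ^ n := by
      rw [← Nat.cast_add, h]
      simp
    linarith
  have hcpos : (0 : ℝ) < ((Finset.univ.filter fun b : Fin n → Bool =>
      cubeVertex b ∈ A).card : ℝ) := lt_of_lt_of_le (by positivity) hcard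
  obtain ⟨b₀, hb₀⟩ := Finset.card_pos.1 (Nat.cast_pos (α := ℝ).1 hcpos)
  obtain ⟨r, hrA, hr⟩ := exists_talagrand_selection n A hA ⟨b₀, (Finset.mem_filter.1 hb₀).2⟩
  set E := ∑ b, Real.exp ((∑ t, (cubeVertex b t - r b t) ^ 2) / 72) with hE
  have hE0 : 0 ≤ E := Finset.sum_nonneg fun _ _ => (Real.exp_pos _).le
  have hE2 : E ≤ 2 * 2 ^ n := by
    have h4 : (4 : ℝ) ^ n = 2 ^ n * 2 ^ n := by rw [← mul_pow]; norm_num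
    have h5 : (2 : ℝ) ^ n / 2 * E ≤ 2 ^ n * 2 ^ n := by
      rw [← h4]; exact (mul_le_mul_of_nonneg_right hcard hE0).trans (le_of_eq_of_le (by congr!) hr)
    have h6 : (0 : ℝ) < 2 ^ n := by positivity
    nlinarith
  have hbad : ∀ b : Fin n → Bool, ¬ Splits U (4 * k) B (fun t => rsign (b t) * x t) →
      Real.exp (k / 18) ≤ Real.exp ((∑ t, (cubeVertex b t - r b t) ^ 2) / 72) := by
    intro b hb
    refine Real.exp_le_exp.2 ?_
    by_contra! hlt
    refine hb ⟨fun t => x t * (cubeVertex b t - r b t), fun t => x t * r b t, fun t => ?_,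
      (hl1 _).trans (by linarith), hrA b⟩
    simp only [cubeVertex]; ring
  have hfin : ((Finset.univ.filter fun b : Fin n → Bool =>
      ¬ Splits U (4 * k) B (fun t => rsign (b t) * x t)).card : ℝ) * Real.exp (k / 18) ≤ E := by
    rw [← nsmul_eq_mul, ← Finset.sum_const]
    exact (Finset.sum_le_sum fun b hb => hbad b (Finset.mem_filter.1 hb).2).trans
      (Finset.sum_le_sum_of_subset_of_nonneg (Finset.filter_subset _ _)
        fun _ _ _ => (Real.exp_pos _).le)
  rw [← le_div_iff₀ (Real.exp_pos _)] at hfin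
  refine hfin.trans ?_
  rw [Real.exp_neg, div_eq_mul_inv, mul_right_comm]
  gcongr

/-- Internal nets for a set of splitting vectors, in the norm `max_i |⟨u_i, ·⟩|`. -/
lemma exists_internal_net {n : ℕ} (hn : 0 < n) (U : Matrix (Fin n) (Fin n) ℝ)
    (hU : ∀ i j, |U i j| ≤ 1) (K : Finset (Fin n → ℝ)) {S B : ℝ} (hS : 0 < S)
    (hK : ∀ z ∈ K, Splits U (S ^ 2) B z) {s : ℕ} (hs : 0 < s) :
    ∃ π : (Fin n → ℝ) → (Fin n → ℝ), (∀ z ∈ K, π z ∈ K) ∧ (K.image π).card ≤ (3 * n) ^ s ∧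
      ∀ z ∈ K, ∀ i, |∑ t, U i t * (z t - π z t)|
        ≤ 2 * (S * Real.sqrt (8 * Real.log (2 * n) / s) + B) := by
  classical
  set D := S * Real.sqrt (8 * Real.log (2 * n) / s) + B with hD
  have hcode : ∀ z : Fin n → ℝ, ∃ q : Fin s → Fin n × SignType, z ∈ K → ∀ i,
      |(∑ j, U i j * z j) - S / s * ∑ t, ((q t).2 : ℝ) * U i (q t).1| ≤ D := by
    intro z
    by_cases hz : z ∈ K
    · obtain ⟨a, c, hac, ha, hc⟩ := hK z hz
      obtain ⟨q, hq⟩ := exists_maurey hn U hU a hS (abs_le_of_sq_le_sq' ha hS.le).2 hs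
      refine ⟨q, fun _ i => ?_⟩
      have e : ∑ j, U i j * z j = ∑ j, U i j * a j + ∑ j, U i j * c j := by
        rw [← Finset.sum_add_distrib]
        exact Finset.sum_congr rfl fun j _ => by rw [hac]; ring
      rw [e, add_sub_right_comm]
      exact (abs_add_le _ _).trans (add_le_add (hq i) (hc i))
    · exact ⟨fun _ => (⟨0, hn⟩, 0), fun h => absurd h hz⟩
  choose q hq using hcode
  let rep : (Fin s → Fin n × SignType) → (Fin n → ℝ) := fun c =>
    if h : ∃ w ∈ K, q w = c then h.choose else 0
  have hrep : ∀ z ∈ K, rep (q z) ∈ K ∧ q (rep (q z)) = q z := by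
    intro z hz
    have h : ∃ w ∈ K, q w = q z := ⟨z, hz, rfl⟩
    simp only [rep, dif_pos h]
    exact h.choose_spec
  refine ⟨fun z => rep (q z), fun z hz => (hrep z hz).1, ?_, fun z hz i => ?_⟩
  · have hsub : (K.image fun z => rep (q z)) ⊆ Finset.univ.image rep := by
      intro w hw
      obtain ⟨z, _, rfl⟩ := Finset.mem_image.1 hw
      exact Finset.mem_image_of_mem _ (Finset.mem_univ _)
    refine (Finset.card_le_card hsub).trans (Finset.card_image_le.trans (le_of_eq ?_))
    have h3 : Fintype.card SignType = 3 := rfl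
    simp [h3, mul_comm]
  · have h1 := hq z hz i
    have h2 := hq _ (hrep z hz).1 i
    rw [(hrep z hz).2] at h2
    have e : ∑ t, U i t * (z t - rep (q z) t)
        = ∑ t, U i t * z t - ∑ t, U i t * rep (q z) t := by
      rw [← Finset.sum_sub_distrib]
      exact Finset.sum_congr rfl fun j _ => by ring
    rw [e]
    rw [abs_le] at h1 h2 ⊢
    constructor <;> linarith [h1.1, h1.2, h2.1, h2.2]

/-- Rademacher sums of differences of squares. -/
lemma exists_dominating_sq_sub {ι : Type*} [Fintype ι] [DecidableEq ι]
    (P : Finset ((ι → ℝ) × (ι → ℝ))) {D R Λ : ℝ} (hD : 0 < D) (hR : 0 < R) (hΛ : 0 < Λ)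
    (hPD : ∀ w ∈ P, ∀ i, |w.1 i - w.2 i| ≤ D)
    (hP1 : ∀ w ∈ P, ∑ i, w.1 i ^ 2 ≤ R ^ 2) (hP2 : ∀ w ∈ P, ∑ i, w.2 i ^ 2 ≤ R ^ 2)
    (hcard : 2 * (P.card : ℝ) ≤ Real.exp Λ) :
    ∃ H : (ι → Bool) → ℝ, (∀ σ, 0 ≤ H σ) ∧
      (∀ σ, ∀ w ∈ P, |∑ i, rsign (σ i) * (w.1 i ^ 2 - w.2 i ^ 2)| ≤ H σ) ∧
      𝔼 σ, H σ ≤ 2 * D * R * Real.sqrt (2 * Λ) := by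
  classical
  obtain ⟨H, h0, h1, h2⟩ := exists_dominating_rademacher
    (P.image fun w i => w.1 i ^ 2 - w.2 i ^ 2) (V := 2 * D * R) (by positivity) hΛ
    (by
      intro c hc
      obtain ⟨w, hw, rfl⟩ := Finset.mem_image.1 hc
      have h : ∀ i, (w.1 i ^ 2 - w.2 i ^ 2) ^ 2 ≤ D ^ 2 * (2 * (w.1 i ^ 2 + w.2 i ^ 2)) := by
        intro i
        have e : (w.1 i ^ 2 - w.2 i ^ 2) ^ 2 = (w.1 i - w.2 i) ^ 2 * (w.1 i + w.2 i) ^ 2 := by ring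
        rw [e]
        refine mul_le_mul ?_ (by nlinarith [sq_nonneg (w.1 i - w.2 i)]) (sq_nonneg _) (sq_nonneg _)
        exact sq_le_sq' (abs_le.1 (hPD w hw i)).1 (abs_le.1 (hPD w hw i)).2
      refine (Finset.sum_le_sum fun i _ => h i).trans ?_
      rw [← Finset.mul_sum, ← Finset.mul_sum, Finset.sum_add_distrib]
      have := hP1 w hw
      have := hP2 w hw
      nlinarith [sq_nonneg D])
    (le_trans (by gcongr; exact Finset.card_image_le) hcard)
  exact ⟨H, h0, fun σ w hw => h1 σ _ (Finset.mem_image_of_mem _ hw), h2⟩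

lemma card_image_prod_mk_le {α β γ : Type*} [DecidableEq β] [DecidableEq γ]
    (K : Finset α) (f : α → β) (g : α → γ) :
    (K.image fun z => (f z, g z)).card ≤ (K.image f).card * (K.image g).card := by
  rw [← Finset.card_product]
  refine Finset.card_le_card fun w hw => ?_
  obtain ⟨z, hz, rfl⟩ := Finset.mem_image.1 hw
  exact Finset.mem_product.2 ⟨Finset.mem_image_of_mem _ hz, Finset.mem_image_of_mem _ hz⟩

lemma two_mul_three_mul_pow_le_exp {n : ℕ} (hn : 2 ≤ n) (s : ℕ) (hs : 1 ≤ s) :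
    2 * (3 * (n : ℝ)) ^ (2 * s) ≤ Real.exp (7 * s * Real.log n) := by
  have hn' : (2 : ℝ) ≤ n := by exact_mod_cast hn
  have e : Real.exp (7 * s * Real.log n) = (n : ℝ) ^ (7 * s) := by
    rw [← Real.rpow_natCast, Real.rpow_def_of_pos (by linarith)]
    push_cast
    ring_nf
  have h3 : 3 * (n : ℝ) ≤ (n : ℝ) ^ 3 := by
    have h4 : (4 : ℝ) ≤ n ^ 2 := by nlinarith
    nlinarith
  calc 2 * (3 * (n : ℝ)) ^ (2 * s) ≤ (n : ℝ) ^ s * ((n : ℝ) ^ 3) ^ (2 * s) := by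
        gcongr
        exact hn'.trans (le_self_pow₀ (by linarith) (by omega))
    _ = _ := by rw [e, ← pow_mul, ← pow_add]; congr 1; ring

/-- Chaining along a sequence of nets, up to a finite level. -/
lemma exists_dominating_chain {ι V : Type*} [Fintype ι] [DecidableEq ι]
    (K : Finset V) (φ : V → ι → ℝ) (π : ℕ → V → V) {n : ℕ} (hn : 2 ≤ n) {X R : ℝ}
    (hX : 0 < X) (hR : 0 < R) (hφR : ∀ z ∈ K, ∑ i, φ z i ^ 2 ≤ R ^ 2)
    (hφ0 : ∀ z ∈ K, ∀ i, |φ z i| ≤ X) (L : ℕ) (hmap : ∀ l ≤ L, ∀ z ∈ K, π l z ∈ K)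
    (hcard : ∀ l ≤ L, (Set.ncard (π l '' K)) ≤ (3 * n) ^ 4 ^ l)
    (hdist : ∀ l ≤ L, ∀ z ∈ K, ∀ i, |φ z i - φ (π l z) i| ≤ X / 2 ^ l) :
    ∃ H : (ι → Bool) → ℝ, (∀ σ, 0 ≤ H σ) ∧
      (∀ σ, ∀ z ∈ K, |∑ i, rsign (σ i) * φ (π L z) i ^ 2| ≤ H σ) ∧
      𝔼 σ, H σ ≤ (L + 1) * (6 * X * R * Real.sqrt (14 * Real.log n)) := by
  classical
  have hn' : (2 : ℝ) ≤ n := by exact_mod_cast hn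
  have hℓ : 0 < Real.log n := Real.log_pos (by linarith)
  have hcard' : ∀ l ≤ L, ((K.image (π l)).card : ℝ) ≤ (3 * n) ^ 4 ^ l := by
    intro l hl
    have := hcard l hl
    rw [← Finset.coe_image, Set.ncard_coe_finset] at this
    exact_mod_cast this
  induction L with
  | zero =>
    obtain ⟨H, h0, h1, h2⟩ := exists_dominating_sq_sub
      (K.image fun z => (φ (π 0 z), (0 : ι → ℝ))) hX hR (Λ := 7 * Real.log n) (by positivity)
      (by
        intro w hw i
        obtain ⟨z, hz, rfl⟩ := Finset.mem_image.1 hw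
        simpa using hφ0 _ (hmap 0 le_rfl z hz) i)
      (by
        intro w hw
        obtain ⟨z, hz, rfl⟩ := Finset.mem_image.1 hw
        exact hφR _ (hmap 0 le_rfl z hz))
      (by
        intro w hw
        obtain ⟨z, hz, rfl⟩ := Finset.mem_image.1 hw
        simpa using (sq_nonneg R))
      (by
        have h := two_mul_three_mul_pow_le_exp hn 1 le_rfl
        have h' := hcard' 0 le_rfl
        have h4 : (K.image fun z => (φ (π 0 z), (0 : ι → ℝ)))
            = (K.image (π 0)).image fun w => (φ w, (0 : ι → ℝ)) := by
          rw [Finset.image_image]; rfl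
        have h5 : ((K.image fun z => (φ (π 0 z), (0 : ι → ℝ))).card : ℝ)
            ≤ (K.image (π 0)).card := by
          rw [h4]; exact_mod_cast Finset.card_image_le
        norm_num at h h'
        nlinarith)
    refine ⟨H, h0, fun σ z hz => ?_, h2.trans ?_⟩
    · simpa using h1 σ _ (Finset.mem_image_of_mem _ hz)
    · rw [← mul_assoc 2 7, show (2 : ℝ) * 7 = 14 by norm_num]
      have : 0 < X * R * Real.sqrt (14 * Real.log n) := by positivity
      push_cast
      linarith
  | succ L ih =>
    obtain ⟨H', h0', h1', h2'⟩ := ih (fun l hl => hmap l (by omega)) (fun l hl => hcard l (by omega))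
      (fun l hl => hdist l (by omega)) (fun l hl => hcard' l (by omega))
    obtain ⟨H, h0, h1, h2⟩ := exists_dominating_sq_sub
      (K.image fun z => (φ (π (L + 1) z), φ (π L z))) (D := 3 * (X / 2 ^ (L + 1)))
      (by positivity) hR (Λ := 7 * (4 ^ (L + 1) : ℕ) * Real.log n) (by positivity)
      (by
        intro w hw i
        obtain ⟨z, hz, rfl⟩ := Finset.mem_image.1 hw
        have a := hdist (L + 1) le_rfl z hz i
        have b := hdist L (by omega) z hz i
        have c : X / 2 ^ L = 2 * (X / 2 ^ (L + 1)) := by rw [pow_succ]; field_simp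
        rw [c] at b
        rw [abs_le] at a b ⊢
        constructor <;> linarith [a.1, a.2, b.1, b.2])
      (by
        intro w hw
        obtain ⟨z, hz, rfl⟩ := Finset.mem_image.1 hw
        exact hφR _ (hmap _ le_rfl z hz))
      (by
        intro w hw
        obtain ⟨z, hz, rfl⟩ := Finset.mem_image.1 hw
        exact hφR _ (hmap _ (by omega) z hz))
      (by
        have h4 : (K.image fun z => (φ (π (L + 1) z), φ (π L z)))
            = (K.image fun z => (π (L + 1) z, π L z)).image fun w => (φ w.1, φ w.2) := by
          rw [Finset.image_image]; rfl
        have h5 : ((K.image fun z => (φ (π (L + 1) z), φ (π L z))).card : ℝ)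
            ≤ (K.image (π (L + 1))).card * (K.image (π L)).card := by
          rw [h4]
          exact_mod_cast Finset.card_image_le.trans (card_image_prod_mk_le _ _ _)
        have h6 : (3 * (n : ℝ)) ^ 4 ^ L ≤ (3 * n) ^ 4 ^ (L + 1) :=
          pow_le_pow_right₀ (by linarith) (Nat.pow_le_pow_right (by norm_num) (by omega))
        refine le_trans ?_ (two_mul_three_mul_pow_le_exp hn _ (Nat.one_le_pow _ _ (by norm_num)))
        rw [two_mul (4 ^ (L + 1)), pow_add]
        gcongr
        refine h5.trans ?_
        gcongr
        · exact hcard' _ le_rfl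
        · exact (hcard' _ (by omega)).trans h6)
    refine ⟨fun σ => H' σ + H σ, fun σ => add_nonneg (h0' σ) (h0 σ), fun σ z hz => ?_, ?_⟩
    · have a := h1' σ z hz
      have b := h1 σ _ (Finset.mem_image_of_mem _ hz)
      simp only [mul_sub, Finset.sum_sub_distrib] at b
      rw [abs_le] at a b ⊢
      constructor <;> linarith [a.1, a.2, b.1, b.2]
    · rw [Finset.expect_add_distrib]
      have e : Real.sqrt (2 * (7 * (4 ^ (L + 1) : ℕ) * Real.log n))
          = 2 ^ (L + 1) * Real.sqrt (14 * Real.log n) := by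
        rw [show 2 * (7 * ((4 ^ (L + 1) : ℕ) : ℝ) * Real.log n)
          = (2 ^ (L + 1)) ^ 2 * (14 * Real.log n) by
            push_cast; rw [← pow_mul, mul_comm (L + 1) 2, pow_mul]; norm_num; ring,
          Real.sqrt_mul (by positivity), Real.sqrt_sq (by positivity)]
      rw [e] at h2
      have e2 : 2 * (3 * (X / 2 ^ (L + 1))) * R * (2 ^ (L + 1) * Real.sqrt (14 * Real.log n))
          = 6 * X * R * Real.sqrt (14 * Real.log n) := by
        field_simp; ring
      rw [e2] at h2
      push_cast
      linarith

set_option maxHeartbeats 400000 in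
/-- Chaining bound for the squares of linear functionals on a set of splitting vectors. -/
lemma exists_dominating_splits {ι : Type*} [Fintype ι] [DecidableEq ι] {n : ℕ} (hn : 2 ≤ n)
    (U : Matrix (Fin n) (Fin n) ℝ) (hU : ∀ i j, |U i j| ≤ 1) (K : Finset (Fin n → ℝ)) {k : ℕ}
    (hk : 1 ≤ k)
    (hK : ∀ z ∈ K, Splits U (min (4 * (k : ℝ)) n) (Real.sqrt (2 * Real.log (4 * n))) z)
    (hcard : 2 * (K.card : ℝ) ≤ Real.exp k) (g : ι → Fin n → ℝ) {Γ R : ℝ} (hΓ : 0 < Γ)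
    (hR : 0 < R)
    (hg : ∀ i (z : Fin n → ℝ) M, (∀ j, |∑ t, U j t * z t| ≤ M) → |∑ t, g i t * z t| ≤ Γ * M)
    (hgR : ∀ z ∈ K, ∑ i, (∑ t, g i t * z t) ^ 2 ≤ R ^ 2) :
    ∃ H : (ι → Bool) → ℝ, (∀ σ, 0 ≤ H σ) ∧
      (∀ σ, ∀ z ∈ K, |∑ i, rsign (σ i) * (∑ t, g i t * z t) ^ 2| ≤ H σ) ∧
      𝔼 σ, H σ ≤ 2200 * Γ * R * Real.sqrt k * Real.log n ^ 2 := by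
  classical
  have hn' : (2 : ℝ) ≤ n := by exact_mod_cast hn
  set ℓ := Real.log n with hℓdef
  have hl2 : Real.log 2 ≤ ℓ := Real.log_le_log (by norm_num) hn'
  have hℓ69 : 0.69 ≤ ℓ := by linarith [Real.log_two_gt_d9]
  have hℓ : 0 < ℓ := by linarith
  have hlog2n : Real.log (2 * n) ≤ 2 * ℓ := by
    rw [Real.log_mul (by norm_num) (by linarith)]; linarith
  have hlog4n : Real.log (4 * n) ≤ 3 * ℓ := by
    rw [Real.log_mul (by norm_num) (by linarith), show (4 : ℝ) = 2 ^ 2 by norm_num, Real.log_pow]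
    push_cast; linarith
  obtain ⟨κ, hκ⟩ : ∃ κ : ℕ, κ = min k n := ⟨_, rfl⟩
  have hκ1 : 1 ≤ κ := by omega
  have hκk : κ ≤ k := by omega
  have hκn : κ ≤ n := by omega
  have hκ' : (1 : ℝ) ≤ κ := by exact_mod_cast hκ1
  set a := Real.sqrt κ with ha
  set c := Real.sqrt ℓ with hc
  have ha1 : 1 ≤ a := Real.one_le_sqrt.2 hκ'
  have ha2 : a ^ 2 = κ := Real.sq_sqrt (by positivity)
  have hc0 : 0 < c := Real.sqrt_pos.2 hℓ
  have hc2 : c ^ 2 = ℓ := Real.sq_sqrt hℓ.le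
  have hc8 : 0.8 ≤ c := by
    rw [hc]; exact Real.le_sqrt_of_sq_le (by norm_num; linarith)
  have hB : Real.sqrt (2 * Real.log (4 * n)) ≤ 2.5 * c := by
    rw [Real.sqrt_le_left (by positivity), mul_pow, hc2]
    norm_num
    linarith
  have hK' : ∀ z ∈ K, Splits U ((2 * a) ^ 2) (2.5 * c) z := by
    intro z hz
    obtain ⟨e, f, h1, h2, h3⟩ := hK z hz
    refine ⟨e, f, h1, h2.trans ?_, fun i => (h3 i).trans hB⟩
    rw [mul_pow, ha2, hκ]
    push_cast
    rcases le_total (k : ℝ) n with h | h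
    · rw [min_eq_left h]; exact (min_le_left _ _).trans (by norm_num)
    · rw [min_eq_right h]; exact (min_le_right _ _).trans (by linarith)
  have hnet := fun l : ℕ => exists_internal_net (by omega) U hU K (by positivity) hK'
    (s := 4 ^ l) (by positivity)
  choose π hπ1 hπ2 hπ3 using hnet
  set L := Nat.log 4 κ with hL
  have hL1 : 4 ^ L ≤ κ := Nat.pow_log_le_self 4 (by omega)
  have hL2 : κ < 4 ^ (L + 1) := Nat.lt_pow_succ_log_self (by norm_num) κ
  have hsq : ∀ l : ℕ, ((2 : ℝ) ^ l) ^ 2 = 4 ^ l := fun l => by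
    rw [← pow_mul, mul_comm, pow_mul]; norm_num
  have hLa : ∀ l ≤ L, (2 : ℝ) ^ l ≤ a := by
    intro l hl
    rw [ha]
    refine Real.le_sqrt_of_sq_le ?_
    rw [hsq]
    exact_mod_cast (Nat.pow_le_pow_right (by norm_num) hl).trans hL1
  have haL : a ≤ 2 * 2 ^ L := by
    rw [ha, Real.sqrt_le_left (by positivity), mul_pow, hsq]
    have : (κ : ℝ) < 4 ^ (L + 1) := by exact_mod_cast hL2
    rw [pow_succ] at this
    linarith
  have hLℓ : (L : ℝ) ≤ ℓ := by
    have h1 : ((4 : ℝ)) ^ L ≤ n := by exact_mod_cast hL1.trans hκn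
    have h2 := Real.log_le_log (by positivity) h1
    rw [Real.log_pow, show (4 : ℝ) = 2 ^ 2 by norm_num, Real.log_pow] at h2
    push_cast at h2
    have h3 : (0 : ℝ) ≤ L := by positivity
    nlinarith [Real.log_two_gt_d9]
  have hdiff : ∀ l ≤ L, ∀ z ∈ K, ∀ i,
      |∑ t, g i t * z t - ∑ t, g i t * π l z t| ≤ 22 * Γ * a * c / 2 ^ l := by
    intro l hl z hz i
    have h1 : ∀ j, |∑ t, U j t * (z t - π l z t)| ≤ 22 * a * c / 2 ^ l := by
      intro j
      refine (hπ3 l z hz j).trans ?_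
      have h2 : Real.sqrt (8 * Real.log (2 * n) / (4 ^ l : ℕ)) ≤ 4 * c / 2 ^ l := by
        rw [Real.sqrt_le_left (by positivity), div_pow, hsq, mul_pow, hc2]
        push_cast
        refine div_le_div_of_nonneg_right ?_ (by positivity)
        linarith
      have h3 : c ≤ a * c / 2 ^ l := by
        rw [le_div_iff₀ (by positivity)]
        nlinarith [hLa l hl]
      have h4 : 2 * a * Real.sqrt (8 * Real.log (2 * n) / (4 ^ l : ℕ))
          ≤ 8 * (a * c / 2 ^ l) := by
        refine (mul_le_mul_of_nonneg_left h2 (by positivity)).trans (le_of_eq ?_)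
        ring
      have e : 22 * a * c / 2 ^ l = 22 * (a * c / 2 ^ l) := by ring
      rw [e]
      linarith
    have h2 := hg i (fun t => z t - π l z t) _ h1
    have e : ∑ t, g i t * (z t - π l z t) = ∑ t, g i t * z t - ∑ t, g i t * π l z t := by
      rw [← Finset.sum_sub_distrib]
      exact Finset.sum_congr rfl fun j _ => by ring
    rw [e] at h2
    refine h2.trans (le_of_eq ?_)
    ring
  have hzero : ∀ z ∈ K, ∀ i, |∑ t, g i t * z t| ≤ 22 * Γ * a * c := by
    intro z hz i
    have h1 : ∀ j, |∑ t, U j t * z t| ≤ 22 * a * c := by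
      intro j
      obtain ⟨e, f, h1, h2, h3⟩ := hK' z hz
      have h4 : ∑ t, |e t| ≤ 2 * a := (abs_le_of_sq_le_sq' h2 (by positivity)).2
      have h5 : |∑ t, U j t * e t| ≤ 2 * a := by
        refine (Finset.abs_sum_le_sum_abs _ _).trans (le_trans (Finset.sum_le_sum fun t _ => ?_) h4)
        rw [abs_mul]
        exact mul_le_of_le_one_left (abs_nonneg _) (hU j t)
      have e1 : ∑ t, U j t * z t = ∑ t, U j t * e t + ∑ t, U j t * f t := by
        rw [← Finset.sum_add_distrib]
        exact Finset.sum_congr rfl fun t _ => by rw [h1]; ring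
      rw [e1]
      refine (abs_add_le _ _).trans ((add_le_add h5 (h3 j)).trans ?_)
      nlinarith
    exact (hg i z _ h1).trans (le_of_eq (by ring))
  have hX : 0 < 22 * Γ * a * c := by positivity
  obtain ⟨H, h0, h1, h2⟩ := exists_dominating_chain K (fun z i => ∑ t, g i t * z t) π hn hX hR hgR
    hzero L (fun l _ => hπ1 l)
    (fun l _ => by rw [← Finset.coe_image, Set.ncard_coe_finset]; exact hπ2 l) hdiff
  obtain ⟨H', h0', h1', h2'⟩ := exists_dominating_sq_sub
    (K.image fun z => (fun i => ∑ t, g i t * z t, fun i => ∑ t, g i t * π L z t))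
    (D := 22 * Γ * a * c / 2 ^ L) (by positivity) hR (Λ := k) (by exact_mod_cast hk)
    (by
      intro w hw i
      obtain ⟨z, hz, rfl⟩ := Finset.mem_image.1 hw
      exact hdiff L le_rfl z hz i)
    (by
      intro w hw
      obtain ⟨z, hz, rfl⟩ := Finset.mem_image.1 hw
      exact hgR z hz)
    (by
      intro w hw
      obtain ⟨z, hz, rfl⟩ := Finset.mem_image.1 hw
      exact hgR _ (hπ1 L z hz))
    (le_trans (by gcongr; exact Finset.card_image_le) hcard)
  refine ⟨fun σ => H σ + H' σ, fun σ => add_nonneg (h0 σ) (h0' σ), fun σ z hz => ?_, ?_⟩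
  · have a := h1 σ z hz
    have b := h1' σ _ (Finset.mem_image_of_mem _ hz)
    simp only [mul_sub, Finset.sum_sub_distrib] at b
    rw [abs_le] at a b ⊢
    constructor <;> linarith [a.1, a.2, b.1, b.2]
  · rw [Finset.expect_add_distrib]
    set b := Real.sqrt k with hb
    have hab : a ≤ b := Real.sqrt_le_sqrt (by exact_mod_cast hκk)
    have hb1 : 1 ≤ b := ha1.trans hab
    have h14 : Real.sqrt (14 * ℓ) ≤ 3.75 * c := by
      rw [Real.sqrt_le_left (by positivity), mul_pow, hc2]
      norm_num
      linarith
    have h2k : Real.sqrt (2 * k) ≤ 1.5 * b := by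
      rw [Real.sqrt_le_left (by positivity), mul_pow, Real.sq_sqrt (by positivity)]
      norm_num
      have : (0 : ℝ) ≤ k := by positivity
      linarith
    have hcl : c ≤ 2 * ℓ ^ 2 := by
      have : c * 0.5 ≤ c * c ^ 3 := by
        gcongr
        calc (0.5 : ℝ) ≤ 0.8 ^ 3 := by norm_num
          _ ≤ c ^ 3 := by gcongr
      have e : c * c ^ 3 = (c ^ 2) ^ 2 := by ring
      rw [e] at this
      rw [← hc2]
      linarith
    have hW : 0 < Γ * R * b := by positivity
    have m1 : 𝔼 σ, H σ ≤ 1300 * (Γ * R * b * ℓ ^ 2) := by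
      calc 𝔼 σ, H σ ≤ (L + 1) * (6 * (22 * Γ * a * c) * R * Real.sqrt (14 * ℓ)) := h2
        _ ≤ (2.5 * ℓ) * (6 * (22 * Γ * b * c) * R * (3.75 * c)) := by
            gcongr
            linarith
        _ = 1237.5 * (Γ * R * b * (ℓ * c ^ 2)) := by ring
        _ ≤ 1300 * (Γ * R * b * ℓ ^ 2) := by
            rw [hc2, ← sq]; gcongr; norm_num
    have m2 : 𝔼 σ, H' σ ≤ 264 * (Γ * R * b * ℓ ^ 2) := by
      have hq : 22 * Γ * a * c / 2 ^ L ≤ 44 * Γ * c := by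
        rw [div_le_iff₀ (by positivity)]
        calc 22 * Γ * a * c ≤ 22 * Γ * (2 * 2 ^ L) * c := by gcongr
          _ = _ := by ring
      calc 𝔼 σ, H' σ ≤ 2 * (22 * Γ * a * c / 2 ^ L) * R * Real.sqrt (2 * k) := h2'
        _ ≤ 2 * (44 * Γ * c) * R * (1.5 * b) := by gcongr
        _ = 132 * (Γ * R * b * c) := by ring
        _ ≤ 132 * (Γ * R * b * (2 * ℓ ^ 2)) := by gcongr
        _ = _ := by ring
    have : 0 < Γ * R * b * ℓ ^ 2 := by positivity
    have e : 2200 * Γ * R * b * ℓ ^ 2 = 2200 * (Γ * R * b * ℓ ^ 2) := by ring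
    rw [e]
    linarith

/-- The least nonnegative upper bound of finitely many reals. -/
lemma exists_least_nonneg_bound {Z : Type*} (K : Finset Z) (F : Z → ℝ) :
    ∃ d : ℝ, 0 ≤ d ∧ (∀ z ∈ K, F z ≤ d) ∧ ∀ b, 0 ≤ b → (∀ z ∈ K, F z ≤ b) → d ≤ b := by
  classical
  refine ⟨(insert 0 (K.image F)).max' (Finset.insert_nonempty _ _), ?_, fun z hz => ?_,
    fun b hb h => ?_⟩
  · exact Finset.le_max' _ _ (Finset.mem_insert_self _ _)
  · exact Finset.le_max' _ _ (Finset.mem_insert_of_mem (Finset.mem_image_of_mem _ hz))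
  · refine Finset.max'_le _ _ _ fun y hy => ?_
    rcases Finset.mem_insert.1 hy with rfl | hy
    · exact hb
    · obtain ⟨z, hz, rfl⟩ := Finset.mem_image.1 hy
      exact h z hz

/-- The expectation of a function of one coordinate. -/
lemma expect_apply_coord {ι Y : Type*} [Fintype ι] [DecidableEq ι] [Fintype Y] [Nonempty Y]
    (i : ι) (f : Y → ℝ) : 𝔼 ω : ι → Y, f (ω i) = 𝔼 y, f y := by
  rw [Fintype.expect_equiv (Equiv.funSplitAt i Y) (fun ω => f (ω i)) (fun w => f w.1)
    (fun ω => rfl), ← Finset.univ_product_univ, Finset.expect_product]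
  simp

/-- Exchange of the samples `ω` and `ω'` in the coordinates where `σ` is false. -/
def swapEquiv {ι Y : Type*} (σ : ι → Bool) : ((ι → Y) × (ι → Y)) ≃ ((ι → Y) × (ι → Y)) where
  toFun w := (fun i => if σ i then w.1 i else w.2 i, fun i => if σ i then w.2 i else w.1 i)
  invFun w := (fun i => if σ i then w.1 i else w.2 i, fun i => if σ i then w.2 i else w.1 i)
  left_inv w := by
    refine Prod.ext (funext fun i => ?_) (funext fun i => ?_) <;>
    · by_cases h : σ i <;> simp [h]
  right_inv w := by
    refine Prod.ext (funext fun i => ?_) (funext fun i => ?_) <;>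
    · by_cases h : σ i <;> simp [h]

/-- Symmetrization of empirical averages. -/
lemma expect_deviation_le_symmetrized {Y Z : Type*} [Fintype Y] [Nonempty Y] {p : ℕ} (hp : 0 < p)
    (K : Finset Z) (h : Z → Y → ℝ) (hmean : ∀ z ∈ K, 𝔼 y, h z y = 1)
    (δ : (Fin p → Y) → ℝ)
    (hδ : ∀ ω b, 0 ≤ b → (∀ z ∈ K, |(1 / p : ℝ) * ∑ i, h z (ω i) - 1| ≤ b) → δ ω ≤ b)
    (H : (Fin p → Y) → (Fin p → Bool) → ℝ) (hH0 : ∀ ω σ, 0 ≤ H ω σ)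
    (hH : ∀ ω σ, ∀ z ∈ K, |∑ i, rsign (σ i) * h z (ω i)| ≤ H ω σ) :
    𝔼 ω, δ ω ≤ 2 / p * 𝔼 ω, 𝔼 σ, H ω σ := by
  have hp' : (0 : ℝ) < p := by exact_mod_cast hp
  choose D hD0 hD1 hD2 using fun w : (Fin p → Y) × (Fin p → Y) =>
    exists_least_nonneg_bound K fun z => |∑ i, (h z (w.1 i) - h z (w.2 i))|
  have step1 : ∀ ω, δ ω ≤ 1 / p * 𝔼 ω', D (ω, ω') := by
    intro ω
    refine hδ ω _ (mul_nonneg (by positivity) (Finset.expect_nonneg fun _ _ => hD0 _)) ?_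
    intro z hz
    have e : (1 / p : ℝ) * ∑ i, h z (ω i) - 1
        = 1 / p * 𝔼 ω' : Fin p → Y, ∑ i, (h z (ω i) - h z (ω' i)) := by
      rw [Finset.expect_sum_comm]
      simp only [Finset.expect_sub_distrib, Fintype.expect_const, expect_apply_coord, hmean z hz]
      rw [Finset.sum_sub_distrib]
      simp
      field_simp
    rw [e, abs_mul, abs_of_pos (show (0 : ℝ) < 1 / p by positivity)]
    gcongr
    refine (Finset.abs_expect_le _ _).trans ?_
    exact Finset.expect_le_expect fun ω' _ => hD1 (ω, ω') z hz
  have step2 : ∀ σ : Fin p → Bool, 𝔼 w, D w ≤ 2 * 𝔼 ω, H ω σ := by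
    intro σ
    have e1 : 𝔼 w, D w = 𝔼 w, D (swapEquiv σ w) :=
      (Fintype.expect_equiv (swapEquiv σ) (fun w => D (swapEquiv σ w)) D fun _ => rfl).symm
    have e2 : 𝔼 w, D (swapEquiv σ w) ≤ 𝔼 w : (Fin p → Y) × (Fin p → Y), (H w.1 σ + H w.2 σ) := by
      refine Finset.expect_le_expect fun w _ => hD2 _ _ (add_nonneg (hH0 _ _) (hH0 _ _)) ?_
      intro z hz
      have e : ∑ i, (h z ((swapEquiv σ w).1 i) - h z ((swapEquiv σ w).2 i))
          = ∑ i, rsign (σ i) * h z (w.1 i) - ∑ i, rsign (σ i) * h z (w.2 i) := by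
        rw [← Finset.sum_sub_distrib]
        refine Finset.sum_congr rfl fun i _ => ?_
        by_cases hs : σ i
        · simp [swapEquiv, hs, rsign]
        · simp [swapEquiv, hs, rsign]; ring
      rw [e]
      exact (abs_sub _ _).trans (add_le_add (hH _ _ z hz) (hH _ _ z hz))
    rw [e1]
    refine e2.trans (le_of_eq ?_)
    rw [Finset.expect_add_distrib, ← Finset.univ_product_univ, Finset.expect_product,
      Finset.expect_product]
    simp only [Fintype.expect_const]
    ring
  have step3 : 𝔼 ω, δ ω ≤ 1 / p * 𝔼 w, D w := by
    rw [← Finset.univ_product_univ, Finset.expect_product, Finset.mul_expect]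
    exact Finset.expect_le_expect fun ω _ => step1 ω
  have step4 : 𝔼 w, D w ≤ 2 * 𝔼 ω, 𝔼 σ, H ω σ := by
    rw [Finset.expect_comm, Finset.mul_expect]
    rw [← Fintype.expect_const (ι := Fin p → Bool) (𝔼 w, D w)]
    exact Finset.expect_le_expect fun σ _ => step2 σ
  calc _ ≤ 1 / p * 𝔼 w, D w := step3
    _ ≤ 1 / p * (2 * 𝔼 ω, 𝔼 σ, H ω σ) := by gcongr
    _ = _ := by ring

/-- Expected deviation of the empirical second moments over a set of splitting vectors. -/
lemma exists_expect_deviation_le {Y : Type*} [Fintype Y] [Nonempty Y] {n p k : ℕ} (hn : 2 ≤ n)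
    (hp : 0 < p) (hk : 1 ≤ k) (U : Matrix (Fin n) (Fin n) ℝ) (hU : ∀ i j, |U i j| ≤ 1)
    (K : Finset (Fin n → ℝ))
    (hK : ∀ z ∈ K, Splits U (min (4 * (k : ℝ)) n) (Real.sqrt (2 * Real.log (4 * n))) z)
    (hcard : 2 * (K.card : ℝ) ≤ Real.exp k) (g : Y → Fin n → ℝ) {Γ : ℝ} (hΓ : 0 < Γ)
    (hg : ∀ y (z : Fin n → ℝ) M, (∀ j, |∑ t, U j t * z t| ≤ M) → |∑ t, g y t * z t| ≤ Γ * M)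
    (hmean : ∀ z ∈ K, 𝔼 y, (∑ t, g y t * z t) ^ 2 = 1)
    {κ : ℝ} (hκ : κ = 4400 * Γ * Real.sqrt k * Real.log n ^ 2 / Real.sqrt p) (hκ1 : κ ≤ 1) :
    ∃ δ : (Fin p → Y) → ℝ, (∀ ω, 0 ≤ δ ω) ∧
      (∀ ω, ∀ z ∈ K, |(1 / p : ℝ) * ∑ i, (∑ t, g (ω i) t * z t) ^ 2 - 1| ≤ δ ω) ∧
      𝔼 ω, δ ω ≤ 2 * κ := by
  have hp' : (0 : ℝ) < p := by exact_mod_cast hp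
  choose δ hδ0 hδ1 hδ2 using fun ω : Fin p → Y =>
    exists_least_nonneg_bound K fun z => |(1 / p : ℝ) * ∑ i, (∑ t, g (ω i) t * z t) ^ 2 - 1|
  refine ⟨δ, hδ0, hδ1, ?_⟩
  have hdom : ∀ ω : Fin p → Y, ∃ H : (Fin p → Bool) → ℝ, (∀ σ, 0 ≤ H σ) ∧
      (∀ σ, ∀ z ∈ K, |∑ i, rsign (σ i) * (∑ t, g (ω i) t * z t) ^ 2| ≤ H σ) ∧
      𝔼 σ, H σ ≤ 2200 * Γ * Real.sqrt (p * (1 + δ ω)) * Real.sqrt k * Real.log n ^ 2 := by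
    intro ω
    have hpos : 0 < p * (1 + δ ω) := mul_pos hp' (by linarith [hδ0 ω])
    refine exists_dominating_splits hn U hU K hk hK hcard (fun i => g (ω i)) hΓ
      (Real.sqrt_pos.2 hpos) (fun i => hg (ω i)) fun z hz => ?_
    rw [Real.sq_sqrt hpos.le]
    have h := (abs_le.1 (hδ1 ω z hz)).2
    rw [one_div, sub_le_iff_le_add, inv_mul_le_iff₀ hp'] at h
    linarith
  choose H hH0 hH1 hH2 using hdom
  have hsym := expect_deviation_le_symmetrized hp K (fun z y => (∑ t, g y t * z t) ^ 2) hmean δ hδ2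
    H hH0 hH1
  have hκ0 : 0 ≤ κ := by rw [hκ]; positivity
  have hsq : Real.sqrt p ^ 2 = p := Real.sq_sqrt hp'.le
  have hsp : 0 < Real.sqrt p := Real.sqrt_pos.2 hp'
  have hω : ∀ ω, 2 / p * 𝔼 σ, H ω σ ≤ κ * (1 + δ ω / 2) := by
    intro ω
    have h1 : Real.sqrt (p * (1 + δ ω)) ≤ Real.sqrt p * (1 + δ ω / 2) := by
      rw [Real.sqrt_mul hp'.le]
      gcongr
      rw [Real.sqrt_le_left (by linarith [hδ0 ω])]
      nlinarith [hδ0 ω]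
    calc 2 / p * 𝔼 σ, H ω σ
        ≤ 2 / p * (2200 * Γ * (Real.sqrt p * (1 + δ ω / 2)) * Real.sqrt k * Real.log n ^ 2) := by
          refine mul_le_mul_of_nonneg_left ((hH2 ω).trans ?_) (by positivity)
          gcongr
      _ = κ * (1 + δ ω / 2) := by
          rw [hκ]
          nth_rw 1 [← hsq]
          field_simp
          ring
  have h3 : 𝔼 ω, δ ω ≤ κ * (1 + (𝔼 ω, δ ω) / 2) := by
    refine hsym.trans ?_
    rw [Finset.mul_expect]
    refine (Finset.expect_le_expect fun ω _ => hω ω).trans (le_of_eq ?_)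
    rw [← Finset.mul_expect, Finset.expect_add_distrib, Fintype.expect_const, Finset.expect_div]
  have h4 : 0 ≤ 𝔼 ω, δ ω := Finset.expect_nonneg fun ω _ => hδ0 ω
  nlinarith

/-- Second moment of a weighted sum of i.i.d. centred variables. -/
lemma expect_sq_weighted_sum {ι Y : Type*} [Fintype ι] [DecidableEq ι] [Fintype Y] [Nonempty Y]
    (c : ι → ℝ) (ξ : Y → ℝ) (hξ : 𝔼 y, ξ y = 0) :
    𝔼 y : ι → Y, (∑ s, c s * ξ (y s)) ^ 2 = (∑ s, c s ^ 2) * 𝔼 y, ξ y ^ 2 := by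
  have hoff : ∀ s s' : ι, s' ≠ s → 𝔼 y : ι → Y, ξ (y s) * ξ (y s') = 0 := by
    intro s s' hs
    rw [Fintype.expect_equiv (Equiv.funSplitAt s Y) (fun y => ξ (y s) * ξ (y s'))
      (fun w => ξ w.1 * ξ (w.2 ⟨s', hs⟩)) (fun y => rfl), ← Finset.univ_product_univ,
      Finset.expect_product]
    simp only [← Finset.mul_expect, ← Finset.expect_mul, hξ, zero_mul]
  have e : ∀ y : ι → Y, (∑ s, c s * ξ (y s)) ^ 2
      = ∑ s, ∑ s', c s * c s' * (ξ (y s) * ξ (y s')) := by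
    intro y
    rw [sq, Finset.sum_mul_sum]
    exact Finset.sum_congr rfl fun s _ => Finset.sum_congr rfl fun s' _ => by ring
  simp only [e]
  rw [Finset.expect_sum_comm, Finset.sum_mul]
  refine Finset.sum_congr rfl fun s _ => ?_
  rw [Finset.expect_sum_comm, Finset.sum_eq_single s]
  · rw [← Finset.mul_expect, ← sq]
    simp only [← sq]
    rw [expect_apply_coord s fun y => ξ y ^ 2]
  · intro s' _ hs
    rw [← Finset.mul_expect, hoff s s' hs, mul_zero]
  · simp

/-- A row of the condensed measurement matrix: a weighted sum of randomly signed rows of `U`. -/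
def condensedRow {n lam : ℕ} (U : Matrix (Fin n) (Fin n) ℝ) (c : Fin lam → ℝ)
    (y : Fin lam → Fin n × Bool) : Fin n → ℝ :=
  fun t => ∑ s, c s * (rsign (y s).2 * U (y s).1 t)

lemma sum_condensedRow_mul {n lam : ℕ} (U : Matrix (Fin n) (Fin n) ℝ) (c : Fin lam → ℝ)
    (y : Fin lam → Fin n × Bool) (z : Fin n → ℝ) :
    ∑ t, condensedRow U c y t * z t = ∑ s, c s * (rsign (y s).2 * ∑ t, U (y s).1 t * z t) := by
  simp only [condensedRow, Finset.sum_mul, Finset.mul_sum]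
  rw [Finset.sum_comm]
  exact Finset.sum_congr rfl fun s _ => Finset.sum_congr rfl fun t _ => by ring

lemma abs_rsign (b : Bool) : |rsign b| = 1 := by cases b <;> simp [rsign]

lemma rsign_sq (b : Bool) : rsign b ^ 2 = 1 := by cases b <;> simp [rsign]

lemma abs_sum_condensedRow_mul_le {n lam : ℕ} (U : Matrix (Fin n) (Fin n) ℝ) (c : Fin lam → ℝ)
    (hc : ∀ s, 0 ≤ c s) {Γ : ℝ} (hcΓ : ∑ s, c s ≤ Γ) (y : Fin lam → Fin n × Bool)
    (z : Fin n → ℝ) (M : ℝ) (hM0 : 0 ≤ M) (hM : ∀ j, |∑ t, U j t * z t| ≤ M) :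
    |∑ t, condensedRow U c y t * z t| ≤ Γ * M := by
  rw [sum_condensedRow_mul]
  refine (Finset.abs_sum_le_sum_abs _ _).trans (le_trans (Finset.sum_le_sum fun s _ => ?_)
    (le_trans (le_of_eq (Finset.sum_mul _ _ _).symm) (mul_le_mul_of_nonneg_right hcΓ hM0)))
  rw [abs_mul, abs_mul, abs_rsign, one_mul, abs_of_nonneg (hc s)]
  exact mul_le_mul_of_nonneg_left (hM _) (hc s)

lemma sum_sq_mulVec_of_orthogonal {n : ℕ} (U : Matrix (Fin n) (Fin n) ℝ)
    (hU : Uᵀ * U = (n : ℝ) • (1 : Matrix (Fin n) (Fin n) ℝ)) (z : Fin n → ℝ) :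
    ∑ j, (∑ t, U j t * z t) ^ 2 = n * ∑ t, z t ^ 2 := by
  have h : (U *ᵥ z) ⬝ᵥ (U *ᵥ z) = (n : ℝ) * (z ⬝ᵥ z) := by
    rw [Matrix.dotProduct_mulVec, Matrix.vecMul_mulVec, hU, Matrix.vecMul_smul, Matrix.vecMul_one,
      smul_dotProduct, smul_eq_mul]
  simpa [dotProduct, Matrix.mulVec, ← sq] using h

lemma expect_sq_sum_condensedRow_mul {n lam : ℕ} (hn : 0 < n) (U : Matrix (Fin n) (Fin n) ℝ)
    (hU : Uᵀ * U = (n : ℝ) • (1 : Matrix (Fin n) (Fin n) ℝ)) (c : Fin lam → ℝ)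
    (hc : ∑ s, c s ^ 2 = 1) (z : Fin n → ℝ) :
    𝔼 y : Fin lam → Fin n × Bool, (∑ t, condensedRow U c y t * z t) ^ 2 = ∑ t, z t ^ 2 := by
  have : Nonempty (Fin n) := ⟨⟨0, hn⟩⟩
  have hn' : (n : ℝ) ≠ 0 := by exact_mod_cast hn.ne'
  simp only [sum_condensedRow_mul]
  rw [expect_sq_weighted_sum c (fun w : Fin n × Bool => rsign w.2 * ∑ t, U w.1 t * z t), hc,
    one_mul]
  · simp only [mul_pow, rsign_sq, one_mul]
    rw [← Finset.univ_product_univ, Finset.expect_product]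
    simp only [Fintype.expect_const]
    rw [Fintype.expect_eq_sum_div_card, sum_sq_mulVec_of_orthogonal U hU, Fintype.card_fin,
      mul_div_cancel_left₀ _ hn']
  · rw [← Finset.univ_product_univ, Finset.expect_product]
    have h0 : ∀ r : ℝ, 𝔼 b : Bool, rsign b * r = 0 := fun r => by
      rw [Fintype.expect_eq_sum_div_card]; simp [rsign]
    simp only [h0, Finset.expect_const_zero]

lemma betaVec_pos {β : ℝ} (hβ : 1 < β) {lam : ℕ} (s : Fin lam) : 0 < betaVec β lam s :=
  zpow_pos (by linarith) _

lemma inv_le_norm2_betaVec (β : ℝ) {lam : ℕ} (hlam : 0 < lam) :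
    β⁻¹ ≤ norm2 (betaVec β lam) := by
  refine Real.le_sqrt_of_sq_le ?_
  have h := Finset.single_le_sum (f := fun j => betaVec β lam j ^ 2) (fun j _ => sq_nonneg _)
    (Finset.mem_univ (⟨0, hlam⟩ : Fin lam))
  refine le_trans (le_of_eq ?_) h
  simp [betaVec]

lemma sum_betaVec_le {β : ℝ} (hβ : 1 < β) (lam : ℕ) : ∑ s, betaVec β lam s ≤ (β - 1)⁻¹ := by
  have hβ0 : β ≠ 0 := by linarith
  have hβ1 : β - 1 ≠ 0 := by linarith
  have h : ∀ m : ℕ, ∑ s ∈ Finset.range m, β ^ (-(s : ℤ) - 1)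
      = (β - 1)⁻¹ * (1 - β ^ (-(m : ℤ))) := by
    intro m
    induction m with
    | zero => simp
    | succ m ih =>
      rw [Finset.sum_range_succ, ih]
      have e : β ^ (-(m : ℤ)) = β * β ^ (-(m : ℤ) - 1) := by
        rw [zpow_sub_one₀ hβ0]; field_simp
      have e2 : -((m + 1 : ℕ) : ℤ) = -(m : ℤ) - 1 := by push_cast; ring
      rw [e2, e]
      field_simp
      ring
  simp only [betaVec]
  rw [Fin.sum_univ_eq_sum_range (fun s : ℕ => β ^ (-(s : ℤ) - 1)), h]
  refine mul_le_of_le_one_right (inv_nonneg.2 (by linarith)) ?_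
  linarith [zpow_pos (show 0 < β by linarith) (-(lam : ℤ))]

/-- The normalized weights `v_β / ‖v_β‖₂`. -/
def unitBetaVec (β : ℝ) (lam : ℕ) : Fin lam → ℝ := fun s => betaVec β lam s / norm2 (betaVec β lam)

lemma norm2_betaVec_pos {β : ℝ} (hβ : 1 < β) {lam : ℕ} (hlam : 0 < lam) :
    0 < norm2 (betaVec β lam) :=
  lt_of_lt_of_le (inv_pos.2 (by linarith)) (inv_le_norm2_betaVec β hlam)

lemma unitBetaVec_nonneg {β : ℝ} (hβ : 1 < β) {lam : ℕ} (hlam : 0 < lam) (s : Fin lam) :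
    0 ≤ unitBetaVec β lam s :=
  div_nonneg (betaVec_pos hβ s).le (norm2_betaVec_pos hβ hlam).le

lemma sum_sq_unitBetaVec {β : ℝ} (hβ : 1 < β) {lam : ℕ} (hlam : 0 < lam) :
    ∑ s, unitBetaVec β lam s ^ 2 = 1 := by
  have h := norm2_betaVec_pos hβ hlam
  have e : norm2 (betaVec β lam) ^ 2 = ∑ s, betaVec β lam s ^ 2 :=
    Real.sq_sqrt (Finset.sum_nonneg fun _ _ => sq_nonneg _)
  simp only [unitBetaVec, div_pow]
  rw [← Finset.sum_div, ← e, div_self (by positivity)]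

lemma sum_unitBetaVec_le {β : ℝ} (hβ : 1 < β) {lam : ℕ} (hlam : 0 < lam) :
    ∑ s, unitBetaVec β lam s ≤ β / (β - 1) := by
  have h := norm2_betaVec_pos hβ hlam
  simp only [unitBetaVec]
  rw [← Finset.sum_div, div_le_iff₀ h]
  have hb : 0 < β := by linarith
  have hb1 : 0 < β - 1 := by linarith
  calc _ ≤ (β - 1)⁻¹ := sum_betaVec_le hβ lam
    _ = β / (β - 1) * β⁻¹ := by field_simp
    _ ≤ _ := by gcongr; exact inv_le_norm2_betaVec β hlam

lemma norm2_eq_norm {n : ℕ} (x : Fin n → ℝ) : norm2 x = ‖WithLp.toLp 2 x‖ := by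
  simp [norm2, EuclideanSpace.norm_eq]

lemma abs_norm2_sub_norm2_le {n : ℕ} (x y : Fin n → ℝ) :
    |norm2 x - norm2 y| ≤ norm2 (x - y) := by
  simp only [norm2_eq_norm, WithLp.toLp_sub]
  exact abs_norm_sub_norm_le _ _

lemma norm2_le_sqrt_mul {p : ℕ} (x : Fin p → ℝ) {M : ℝ} (hM : 0 ≤ M) (hx : ∀ i, |x i| ≤ M) :
    norm2 x ≤ Real.sqrt p * M := by
  rw [norm2, Real.sqrt_le_left (by positivity), mul_pow, Real.sq_sqrt (by positivity)]
  calc ∑ i, x i ^ 2 ≤ ∑ _i : Fin p, M ^ 2 :=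
        Finset.sum_le_sum fun i _ => sq_le_sq' (abs_le.1 (hx i)).1 (abs_le.1 (hx i)).2
    _ = p * M ^ 2 := by simp

lemma kronRow_mulVec {p lam : ℕ} (v : Fin lam → ℝ) (x : Fin (p * lam) → ℝ) (i : Fin p) :
    (kronRow p v *ᵥ x) i = ∑ s, v s * x (finProdFinEquiv (i, s)) := by
  simp only [Matrix.mulVec, dotProduct]
  rw [← Equiv.sum_comp finProdFinEquiv, Fintype.sum_prod_type, Finset.sum_eq_single i]
  · refine Finset.sum_congr rfl fun s _ => ?_
    have hl : 0 < lam := Fin.pos s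
    have h1 : ((s : ℕ) + lam * (i : ℕ)) / lam = i := by
      rw [Nat.add_mul_div_left _ _ hl, Nat.div_eq_of_lt s.2, zero_add]
    have h2 : ((s : ℕ) + lam * (i : ℕ)) % lam = s := by
      rw [Nat.add_mul_mod_self_left, Nat.mod_eq_of_lt s.2]
    simp [kronRow, h1, h2]
  · intro i' _ hi
    refine Finset.sum_eq_zero fun s _ => ?_
    have hl : 0 < lam := Fin.pos s
    have h1 : ((s : ℕ) + lam * (i' : ℕ)) / lam = i' := by
      rw [Nat.add_mul_div_left _ _ hl, Nat.div_eq_of_lt s.2, zero_add]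
    have h3 : ¬ (i' : ℕ) = i := fun h => hi (Fin.ext h)
    simp [kronRow, h1, h3]
  · simp

lemma abs_nsU_le_one {β : ℝ} (hβ1 : 1 < β) (hβ2 : β ≤ 10 / 9) (y : ℕ → ℝ)
    (hy : ∀ s, |y s| ≤ 8 / 9) (s : ℕ) : |nsU β y s| ≤ 1 := by
  induction s with
  | zero => simp [nsU]
  | succ s ih =>
    have h1 := hy s
    rw [abs_le] at ih h1
    have h2 : -2 ≤ y s + β * nsU β y s := by nlinarith [ih.1, ih.2, h1.1]
    have h3 : y s + β * nsU β y s ≤ 2 := by nlinarith [ih.1, ih.2, h1.2]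
    rw [nsU, qsgn]
    split_ifs with h
    · rw [abs_le]; constructor <;> linarith
    · rw [abs_le]; constructor <;> linarith

/-- The quantization error of a block, weighted by `v_β`, telescopes. -/
lemma abs_kronRow_mulVec_sub_Qbeta_le {β : ℝ} (hβ1 : 1 < β) (hβ2 : β ≤ 10 / 9) {p lam : ℕ}
    (y : Fin (p * lam) → ℝ) (hy : ∀ j, |y j| ≤ 8 / 9) (i : Fin p) :
    |(kronRow p (betaVec β lam) *ᵥ (y - Qbeta β p lam y)) i| ≤ β ^ (-(lam : ℤ)) := by
  have hβ0 : β ≠ 0 := by linarith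
  let yb : ℕ → ℝ := fun s =>
    if h : (i : ℕ) * lam + s < p * lam then y ⟨(i : ℕ) * lam + s, h⟩ else 0
  have hyb : ∀ s, |yb s| ≤ 8 / 9 := by
    intro s
    simp only [yb]
    split_ifs
    · exact hy _
    · norm_num
  have hdiff : ∀ s : Fin lam, (y - Qbeta β p lam y) (finProdFinEquiv (i, s))
      = nsU β yb (s + 1) - β * nsU β yb s := by
    intro s
    have hl : 0 < lam := Fin.pos s
    have h1 : ((s : ℕ) + lam * (i : ℕ)) / lam = i := by
      rw [Nat.add_mul_div_left _ _ hl, Nat.div_eq_of_lt s.2, zero_add]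
    have h2 : ((s : ℕ) + lam * (i : ℕ)) % lam = s := by
      rw [Nat.add_mul_mod_self_left, Nat.mod_eq_of_lt s.2]
    have hv : ((finProdFinEquiv (i, s) : Fin (p * lam)) : ℕ) = s + lam * i := rfl
    have hq : Qbeta β p lam y (finProdFinEquiv (i, s)) = qsgn (yb s + β * nsU β yb s) := by
      simp only [Qbeta, hv, h1, h2, yb]
    have hys : y (finProdFinEquiv (i, s)) = yb s := by
      have hlt : (i : ℕ) * lam + s < p * lam := by
        have := (finProdFinEquiv (i, s) : Fin (p * lam)).2
        rw [hv] at this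
        linarith [mul_comm lam (i : ℕ)]
      simp only [yb, dif_pos hlt]
      congr 1
      refine Fin.ext ?_
      rw [hv]
      simp only
      ring
    rw [Pi.sub_apply, hq, hys, nsU]
    ring
  rw [kronRow_mulVec]
  simp only [hdiff, betaVec]
  rw [Fin.sum_univ_eq_sum_range
    (fun s : ℕ => β ^ (-(s : ℤ) - 1) * (nsU β yb (s + 1) - β * nsU β yb s))]
  have htel : ∀ m : ℕ, ∑ s ∈ Finset.range m,
      β ^ (-(s : ℤ) - 1) * (nsU β yb (s + 1) - β * nsU β yb s) = β ^ (-(m : ℤ)) * nsU β yb m := by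
    intro m
    induction m with
    | zero => simp [nsU]
    | succ m ih =>
      rw [Finset.sum_range_succ, ih]
      have e : β ^ (-(m : ℤ)) = β * β ^ (-(m : ℤ) - 1) := by
        rw [zpow_sub_one₀ hβ0]; field_simp
      have e2 : -((m + 1 : ℕ) : ℤ) = -(m : ℤ) - 1 := by push_cast; ring
      rw [e2, e]
      ring
  have hpos : 0 < β ^ (-(lam : ℤ)) := zpow_pos (by linarith) _
  rw [htel, abs_mul, abs_of_pos hpos]
  exact mul_le_of_le_one_right hpos.le (abs_nsU_le_one hβ1 hβ2 yb hyb lam)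

/-- Quantization perturbs the condensed measurements of a difference only slightly. -/
lemma abs_norm2_condensed_sub_le {β : ℝ} (hβ1 : 1 < β) (hβ2 : β ≤ 10 / 9) {n p lam : ℕ}
    (hp : 0 < p) (hlam : 0 < lam) (A : Matrix (Fin (p * lam)) (Fin n) ℝ) (x x' : Fin n → ℝ)
    (hx : ∀ j, |(A *ᵥ x) j| ≤ 1) (hx' : ∀ j, |(A *ᵥ x') j| ≤ 1) :
    |norm2 (((9 / (8 * norm2 (betaVec β lam) * Real.sqrt p)) • kronRow p (betaVec β lam)) *ᵥ
        (Qbeta β p lam (fun j => (8 / 9) * (A *ᵥ x) j)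
          - Qbeta β p lam (fun j => (8 / 9) * (A *ᵥ x') j)))
      - norm2 (fun i : Fin p => (1 / Real.sqrt p)
          * ∑ s, unitBetaVec β lam s * (A *ᵥ (x - x')) (finProdFinEquiv (i, s)))|
      ≤ 9 / 4 * β ^ (-(lam : ℤ) + 1) := by
  have hβ0 : 0 < β := by linarith
  have hv := norm2_betaVec_pos hβ1 hlam
  have hv' := inv_le_norm2_betaVec β hlam
  have hsp : 0 < Real.sqrt p := Real.sqrt_pos.2 (by exact_mod_cast hp)
  set v := norm2 (betaVec β lam) with hvdef
  set V := kronRow p (betaVec β lam) with hV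
  set y : Fin (p * lam) → ℝ := fun j => (8 / 9) * (A *ᵥ x) j with hy
  set y' : Fin (p * lam) → ℝ := fun j => (8 / 9) * (A *ᵥ x') j with hy'
  have hyb : ∀ (w : Fin n → ℝ), (∀ j, |(A *ᵥ w) j| ≤ 1) → ∀ j, |8 / 9 * (A *ᵥ w) j| ≤ 8 / 9 := by
    intro w hw j
    rw [abs_mul, abs_of_pos (by norm_num : (0 : ℝ) < 8 / 9)]
    linarith [hw j]
  have e1 : (fun i : Fin p => (1 / Real.sqrt p)
      * ∑ s, unitBetaVec β lam s * (A *ᵥ (x - x')) (finProdFinEquiv (i, s)))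
      = ((9 / (8 * v * Real.sqrt p)) • V) *ᵥ (y - y') := by
    funext i
    rw [Matrix.smul_mulVec, Pi.smul_apply, hV, kronRow_mulVec, smul_eq_mul, Finset.mul_sum,
      Finset.mul_sum]
    refine Finset.sum_congr rfl fun s _ => ?_
    simp only [hy, hy', Pi.sub_apply, Matrix.mulVec_sub, unitBetaVec, ← hvdef]
    field_simp
  rw [e1]
  refine (abs_norm2_sub_norm2_le _ _).trans ?_
  rw [← Matrix.mulVec_sub]
  refine (norm2_le_sqrt_mul _ (M := 9 / (8 * v * Real.sqrt p) * (2 * β ^ (-(lam : ℤ))))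
    (by positivity) fun i => ?_).trans ?_
  · have e2 : Qbeta β p lam y - Qbeta β p lam y' - (y - y')
        = (y' - Qbeta β p lam y') - (y - Qbeta β p lam y) := by abel
    rw [Matrix.smul_mulVec, Pi.smul_apply, smul_eq_mul, abs_mul, abs_of_pos (by positivity), e2,
      Matrix.mulVec_sub, Pi.sub_apply]
    gcongr
    refine (abs_sub _ _).trans ?_
    linarith [abs_kronRow_mulVec_sub_Qbeta_le hβ1 hβ2 y (hyb x hx) i,
      abs_kronRow_mulVec_sub_Qbeta_le hβ1 hβ2 y' (hyb x' hx') i]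
  · have hz : 0 < β ^ (-(lam : ℤ)) := zpow_pos hβ0 _
    rw [zpow_add₀ hβ0.ne', zpow_one]
    have e3 : Real.sqrt p * (9 / (8 * v * Real.sqrt p) * (2 * β ^ (-(lam : ℤ))))
        = 9 / 4 * (β ^ (-(lam : ℤ)) * v⁻¹) := by
      field_simp
      ring
    rw [e3]
    gcongr
    exact inv_le_of_inv_le₀ hβ0 hv'

lemma signedRows_mulVec {n m : ℕ} (U : Matrix (Fin n) (Fin n) ℝ) (r : Fin m → Fin n)
    (ε : Fin m → Bool) (b : Fin n → Bool) (x : Fin n → ℝ) (j : Fin m) :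
    (((Matrix.of fun j t => rsign (ε j) * U (r j) t : Matrix (Fin m) (Fin n) ℝ)
      * Matrix.diagonal fun t => rsign (b t)) *ᵥ x) j
      = rsign (ε j) * ∑ t, U (r j) t * (rsign (b t) * x t) := by
  rw [← Matrix.mulVec_mulVec]
  simp only [Matrix.mulVec, dotProduct, Matrix.of_apply]
  rw [Finset.mul_sum]
  refine Finset.sum_congr rfl fun t _ => ?_
  have e : ∑ t', Matrix.diagonal (fun t => rsign (b t)) t t' * x t' = rsign (b t) * x t :=
    Matrix.mulVec_diagonal (fun t => rsign (b t)) x t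
  rw [e]
  ring

lemma abs_sqrt_sub_one_le {q : ℝ} (hq : 0 ≤ q) : |Real.sqrt q - 1| ≤ |q - 1| := by
  have e : q - 1 = (Real.sqrt q - 1) * (Real.sqrt q + 1) := by
    nlinarith [Real.mul_self_sqrt hq]
  rw [e, abs_mul]
  refine le_mul_of_one_le_right (abs_nonneg _) ?_
  have := Real.sqrt_nonneg q
  rw [abs_of_nonneg (by linarith)]
  linarith

/-- The embedding property for a pair follows from concentration of the second moments of the
condensed measurements in the direction of their difference. -/
lemma embedding_of_deviation {β : ℝ} (hβ1 : 1 < β) (hβ2 : β ≤ 10 / 9) {n p lam : ℕ}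
    (hp : 0 < p) (hlam : 0 < lam) (U : Matrix (Fin n) (Fin n) ℝ) (hU : ∀ i j, |U i j| ≤ 1)
    (r : Fin (p * lam) → Fin n) (ε : Fin (p * lam) → Bool) (b : Fin n → Bool)
    (x x' : Fin n → ℝ) (hx : norm1 x ≤ 1) (hx' : norm1 x' ≤ 1) {α : ℝ}
    (hdev : x ≠ x' → |(1 / p : ℝ) * ∑ i : Fin p, (∑ t, condensedRow U (unitBetaVec β lam)
        (fun s => (r (finProdFinEquiv (i, s)), ε (finProdFinEquiv (i, s)))) t
        * (rsign (b t) * ((x t - x' t) / norm2 (x - x')))) ^ 2 - 1| ≤ α) :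
    let A : Matrix (Fin (p * lam)) (Fin n) ℝ :=
      (Matrix.of fun j t => rsign (ε j) * U (r j) t) * Matrix.diagonal fun t => rsign (b t)
    |norm2 (((9 / (8 * norm2 (betaVec β lam) * Real.sqrt p)) • kronRow p (betaVec β lam)) *ᵥ
        (Qbeta β p lam (fun j => (8 / 9) * (A *ᵥ x) j)
          - Qbeta β p lam (fun j => (8 / 9) * (A *ᵥ x') j))) - norm2 (x - x')|
      ≤ α * norm2 (x - x') + 9 / 4 * β ^ (-(lam : ℤ) + 1) := by
  intro A
  have hA : ∀ w : Fin n → ℝ, norm1 w ≤ 1 → ∀ j, |(A *ᵥ w) j| ≤ 1 := by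
    intro w hw j
    rw [signedRows_mulVec, abs_mul, abs_rsign, one_mul]
    refine (Finset.abs_sum_le_sum_abs _ _).trans (le_trans (Finset.sum_le_sum fun t _ => ?_) hw)
    rw [abs_mul, abs_mul, abs_rsign, one_mul]
    exact mul_le_of_le_one_left (abs_nonneg _) (hU _ _)
  have hq := abs_norm2_condensed_sub_le hβ1 hβ2 hp hlam A x x' (hA x hx) (hA x' hx')
  set W := norm2 (fun i : Fin p => (1 / Real.sqrt p)
    * ∑ s, unitBetaVec β lam s * (A *ᵥ (x - x')) (finProdFinEquiv (i, s))) with hW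
  suffices h : |W - norm2 (x - x')| ≤ α * norm2 (x - x') by
    refine (abs_sub_le _ W _).trans ?_
    linarith
  by_cases hxx : x = x'
  · subst hxx
    simp [hW, norm2]
  have hd : 0 < norm2 (x - x') := by
    refine Real.sqrt_pos.2 (lt_of_le_of_ne (Finset.sum_nonneg fun _ _ => sq_nonneg _) fun h => ?_)
    refine hxx (funext fun t => ?_)
    have := (Finset.sum_eq_zero_iff_of_nonneg fun _ _ => sq_nonneg _).1 h.symm t (Finset.mem_univ t)
    exact sub_eq_zero.1 (pow_eq_zero_iff two_ne_zero |>.1 this)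
  have hdev' := hdev hxx
  set d := norm2 (x - x') with hddef
  set q := (1 / p : ℝ) * ∑ i : Fin p, (∑ t, condensedRow U (unitBetaVec β lam)
        (fun s => (r (finProdFinEquiv (i, s)), ε (finProdFinEquiv (i, s)))) t
        * (rsign (b t) * ((x t - x' t) / d))) ^ 2 with hqdef
  have hq0 : 0 ≤ q := mul_nonneg (by positivity) (Finset.sum_nonneg fun _ _ => sq_nonneg _)
  have hp' : (0 : ℝ) < p := by exact_mod_cast hp
  have hWd : W = d * Real.sqrt q := by
    rw [hW, norm2, ← Real.sqrt_sq hd.le, ← Real.sqrt_mul (sq_nonneg _), hqdef,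
      Finset.mul_sum, Finset.mul_sum]
    congr 1
    refine Finset.sum_congr rfl fun i _ => ?_
    rw [sum_condensedRow_mul, mul_pow, div_pow, one_pow, Real.sq_sqrt hp'.le, mul_left_comm,
      ← mul_pow, Finset.mul_sum]
    congr 2
    refine Finset.sum_congr rfl fun s _ => ?_
    rw [signedRows_mulVec, mul_left_comm d, mul_left_comm d]
    congr 2
    rw [Finset.mul_sum]
    refine Finset.sum_congr rfl fun t _ => ?_
    simp only [Pi.sub_apply]
    field_simp
  have e : W - d = d * (Real.sqrt q - 1) := by rw [hWd]; ring
  rw [e, abs_mul, abs_of_pos hd, mul_comm α]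
  exact mul_le_mul_of_nonneg_left ((abs_sqrt_sub_one_le hq0).trans hdev') hd.le

open Classical in
/-- A union bound over a product sample space, conditioning on a good event for one factor. -/
lemma unifProb_ge_of_conditional {Ω B Y : Type*} [Fintype Ω] [Fintype B] [Fintype Y] [Nonempty B]
    [Nonempty Y] (e : Ω ≃ B × Y) (P : Ω → Prop) (G : B → Prop) (E : B → Y → Prop) {η ρ : ℝ}
    (hρ : 0 ≤ ρ)
    (hG : ((Finset.univ.filter fun b => ¬ G b).card : ℝ) ≤ η * Fintype.card B)
    (hE : ∀ b, G b → ((Finset.univ.filter fun y => ¬ E b y).card : ℝ) ≤ ρ * Fintype.card Y)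
    (hP : ∀ ω, G (e ω).1 → E (e ω).1 (e ω).2 → P ω) : unifProb P ≥ 1 - ρ - η := by
  have hY : (0 : ℝ) < Fintype.card Y := by exact_mod_cast Fintype.card_pos
  have hB : (0 : ℝ) < Fintype.card B := by exact_mod_cast Fintype.card_pos
  have hΩ : (Fintype.card Ω : ℝ) = Fintype.card B * Fintype.card Y := by
    rw [Fintype.card_congr e, Fintype.card_prod, Nat.cast_mul]
  have hcompl : (Nat.card {ω // P ω} : ℝ)
      + ((Finset.univ.filter fun ω => ¬ P ω).card : ℝ) = Fintype.card Ω := by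
    rw [Nat.card_eq_fintype_card, Fintype.card_subtype, ← Nat.cast_add,
      Finset.card_filter_add_card_filter_not, Finset.card_univ]
  have hbad : ((Finset.univ.filter fun ω => ¬ P ω).card : ℝ)
      ≤ ∑ b : B, (ρ * Fintype.card Y + if ¬ G b then (Fintype.card Y : ℝ) else 0) := by
    have h1 : (Finset.univ.filter fun ω => ¬ P ω).card
        ≤ (Finset.univ.filter fun w : B × Y => ¬ (G w.1 ∧ E w.1 w.2)).card := by
      refine Finset.card_le_card_of_injOn e (fun ω hω => ?_) e.injective.injOn
      simp only [Finset.coe_filter, Finset.mem_univ, true_and, Set.mem_ofPred_eq] at hω ⊢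
      exact fun h => hω (hP ω h.1 h.2)
    have h2 : ((Finset.univ.filter fun w : B × Y => ¬ (G w.1 ∧ E w.1 w.2)).card : ℝ)
        = ∑ b : B, ((Finset.univ.filter fun y : Y => ¬ (G b ∧ E b y)).card : ℝ) := by
      simp only [Finset.card_filter, Fintype.sum_prod_type]
      push_cast
      rfl
    refine le_trans (by exact_mod_cast h1) (h2.le.trans (Finset.sum_le_sum fun b _ => ?_))
    by_cases hb : G b
    · simpa [hb] using hE b hb
    · simp only [hb, false_and, not_false_eq_true, if_true, Finset.filter_true, Finset.card_univ]
      linarith [mul_nonneg hρ hY.le]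
  have hsum : ∑ b : B, (ρ * Fintype.card Y + if ¬ G b then (Fintype.card Y : ℝ) else 0)
      ≤ (ρ + η) * Fintype.card Ω := by
    rw [Finset.sum_add_distrib, ← Finset.sum_filter, Finset.sum_const, Finset.sum_const,
      nsmul_eq_mul, nsmul_eq_mul, Finset.card_univ, hΩ]
    nlinarith
  rw [unifProb, ge_iff_le, le_div_iff₀ (by rw [hΩ]; positivity)]
  linarith

/-- Regrouping of the sample space into the signs of `D_ε` and the `p` blocks of `Φ`. -/
def sampleEquiv (n p lam : ℕ) :
    ((Fin (p * lam) → Fin n) × (Fin (p * lam) → Bool) × (Fin n → Bool))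
      ≃ (Fin n → Bool) × (Fin p → Fin lam → Fin n × Bool) where
  toFun ω := (ω.2.2, fun i s => (ω.1 (finProdFinEquiv (i, s)), ω.2.1 (finProdFinEquiv (i, s))))
  invFun w := (fun j => (w.2 (finProdFinEquiv.symm j).1 (finProdFinEquiv.symm j).2).1,
    fun j => (w.2 (finProdFinEquiv.symm j).1 (finProdFinEquiv.symm j).2).2, w.1)
  left_inv ω := by
    simp only [Prod.mk.eta, Equiv.apply_symm_apply]
  right_inv w := by
    simp only [Equiv.symm_apply_apply, Prod.mk.eta]

open Classical in
lemma card_lt_le_of_expect_le {Y : Type*} [Fintype Y] [Nonempty Y] (δ : Y → ℝ) (hδ : ∀ y, 0 ≤ δ y)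
    {α ρ : ℝ} (hα : 0 < α) (h : 𝔼 y, δ y ≤ α * ρ) :
    ((Finset.univ.filter fun y => ¬ δ y ≤ α).card : ℝ) ≤ ρ * Fintype.card Y := by
  have hY : (0 : ℝ) < Fintype.card Y := by exact_mod_cast Fintype.card_pos
  rw [Fintype.expect_eq_sum_div_card, div_le_iff₀ hY] at h
  have h1 : ((Finset.univ.filter fun y => ¬ δ y ≤ α).card : ℝ) * α ≤ ∑ y, δ y := by
    rw [← nsmul_eq_mul, ← Finset.sum_const]
    exact (Finset.sum_le_sum fun y hy => (not_le.1 (Finset.mem_filter.1 hy).2).le).trans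
      (Finset.sum_le_sum_of_subset_of_nonneg (Finset.filter_subset _ _) fun y _ _ => hδ y)
  nlinarith

/-- The normalized differences of distinct elements of a finite set. -/
lemma exists_unit_differences {n : ℕ} (T : Finset (Fin n → ℝ)) :
    ∃ D : Finset (Fin n → ℝ), D.card ≤ T.card ^ 2 ∧ (∀ z ∈ D, ∑ t, z t ^ 2 = 1) ∧
      ∀ x ∈ T, ∀ x' ∈ T, x ≠ x' → (fun t => (x t - x' t) / norm2 (x - x')) ∈ D := by
  classical
  refine ⟨((T ×ˢ T).filter fun w => w.1 ≠ w.2).image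
    fun w t => (w.1 t - w.2 t) / norm2 (w.1 - w.2), ?_, ?_, ?_⟩
  · refine Finset.card_image_le.trans ((Finset.card_filter_le _ _).trans ?_)
    rw [Finset.card_product, sq]
  · intro z hz
    obtain ⟨⟨x, x'⟩, hw, rfl⟩ := Finset.mem_image.1 hz
    have hxx : x ≠ x' := (Finset.mem_filter.1 hw).2
    have e : norm2 (x - x') ^ 2 = ∑ t, (x t - x' t) ^ 2 :=
      Real.sq_sqrt (Finset.sum_nonneg fun _ _ => sq_nonneg _)
    simp only [div_pow]
    rw [← Finset.sum_div, ← e, div_self]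
    rw [e]
    intro h
    refine hxx (funext fun t => ?_)
    have := (Finset.sum_eq_zero_iff_of_nonneg fun _ _ => sq_nonneg _).1 h t (Finset.mem_univ t)
    exact sub_eq_zero.1 (pow_eq_zero_iff two_ne_zero |>.1 this)
  · intro x hx x' hx' hxx
    exact Finset.mem_image.2 ⟨(x, x'), Finset.mem_filter.2 ⟨Finset.mem_product.2 ⟨hx, hx'⟩, hxx⟩, rfl⟩

open Classical in
/-- With high probability, the signs make all the vectors of a finite set split. -/
lemma card_exists_not_splits_le {n k N : ℕ} (hn : 0 < n) (U : Matrix (Fin n) (Fin n) ℝ)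
    (hU : ∀ i j, |U i j| ≤ 1) (D : Finset (Fin n → ℝ)) (hN : 0 < N) (hD : D.card ≤ N ^ 2)
    (hD1 : ∀ z ∈ D, ∑ t, z t ^ 2 = 1) {ν : ℝ} (hν : 0 < ν)
    (hk : 40 * (Real.log (8 * (N : ℝ)) + ν) ≤ (k : ℝ)) :
    ((Finset.univ.filter fun b : Fin n → Bool => ¬ ∀ z ∈ D,
        Splits U (min (4 * (k : ℝ)) n) (Real.sqrt (2 * Real.log (4 * n)))
          (fun t => rsign (b t) * z t)).card : ℝ)
      ≤ Real.exp (-ν) * Fintype.card (Fin n → Bool) := by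
  have hN' : (1 : ℝ) ≤ N := by exact_mod_cast hN
  have hlog : 0 ≤ Real.log (8 * (N : ℝ)) := Real.log_nonneg (by linarith)
  have hexp : Real.exp (-((k : ℝ) / 18)) ≤ (8 * (N : ℝ))⁻¹ ^ 2 * Real.exp (-ν) := by
    rw [← Real.exp_log (show 0 < (8 * (N : ℝ))⁻¹ ^ 2 by positivity), ← Real.exp_add]
    refine Real.exp_le_exp.2 ?_
    rw [Real.log_pow, Real.log_inv]
    push_cast
    linarith
  have hsub : (Finset.univ.filter fun b : Fin n → Bool => ¬ ∀ z ∈ D,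
        Splits U (min (4 * (k : ℝ)) n) (Real.sqrt (2 * Real.log (4 * n)))
          (fun t => rsign (b t) * z t))
      ⊆ D.biUnion fun z => Finset.univ.filter fun b : Fin n → Bool =>
        ¬ Splits U (min (4 * (k : ℝ)) n) (Real.sqrt (2 * Real.log (4 * n)))
          (fun t => rsign (b t) * z t) := by
    intro b hb
    have hb' := (Finset.mem_filter.1 hb).2
    push Not at hb'
    obtain ⟨z, hz, hzb⟩ := hb'
    exact Finset.mem_biUnion.2 ⟨z, hz, Finset.mem_filter.2 ⟨Finset.mem_univ _, hzb⟩⟩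
  have h1 := (Finset.card_le_card hsub).trans Finset.card_biUnion_le
  refine le_trans (Nat.cast_le (α := ℝ).2 h1) ?_
  push_cast
  refine (Finset.sum_le_sum fun z hz => card_not_splits_le hn U hU z (hD1 z hz).le (k : ℝ)).trans ?_
  rw [Finset.sum_const, nsmul_eq_mul]
  have hD' : (D.card : ℝ) ≤ (N : ℝ) ^ 2 := by exact_mod_cast hD
  calc (D.card : ℝ) * (2 * Real.exp (-((k : ℝ) / 18)) * 2 ^ n)
      ≤ (N : ℝ) ^ 2 * (2 * ((8 * (N : ℝ))⁻¹ ^ 2 * Real.exp (-ν)) * 2 ^ n) := by gcongr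
    _ = 1 / 32 * (Real.exp (-ν) * 2 ^ n) := by field_simp; norm_num
    _ ≤ 1 * (Real.exp (-ν) * 2 ^ n) := by gcongr; norm_num
    _ = _ := by simp

/-- fast binary embedding of a finite set `𝒯 ⊂ B₁ⁿ` via distributed
noise-shaping quantization of sign-randomized bounded orthogonal measurements. -/
theorem stmt7 (β : ℝ) (hβ1 : 1 < β) (hβ2 : β ≤ 10 / 9) :
    ∃ C₁ C₂ : ℝ, 0 < C₁ ∧ 0 < C₂ ∧
      ∀ (n p lam : ℕ) (U : Matrix (Fin n) (Fin n) ℝ) (T : Finset (Fin n → ℝ))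
        (α ρ ν : ℝ) (k : ℕ),
        2 ≤ n → 0 < p → 0 < lam →
        Uᵀ * U = (n : ℝ) • (1 : Matrix (Fin n) (Fin n) ℝ) →
        (∀ i j, |U i j| ≤ 1) →
        (∀ x ∈ T, norm1 x ≤ 1) →
        0 < α → α < 1 → 0 < ρ → ρ < 1 → 0 < ν →
        40 * (Real.log (8 * (T.card : ℝ)) + ν) ≤ (k : ℝ) →
        p ≤ p * lam →
        C₁ * (k : ℝ) * (Real.log n) ^ 4 / (α ^ 2 * ρ ^ 2) ≤ (p : ℝ) →
        unifProb (fun ω : (Fin (p * lam) → Fin n) × (Fin (p * lam) → Bool) × (Fin n → Bool) =>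
            let Φ : Matrix (Fin (p * lam)) (Fin n) ℝ :=
              Matrix.of fun j t => rsign (ω.2.1 j) * U (ω.1 j) t
            let Dd : Matrix (Fin n) (Fin n) ℝ := Matrix.diagonal fun t => rsign (ω.2.2 t)
            let f : (Fin n → ℝ) → (Fin (p * lam) → ℝ) :=
              fun x => Qbeta β p lam (fun j => (8 / 9) * (Φ * Dd).mulVec x j)
            let Vt : Matrix (Fin p) (Fin (p * lam)) ℝ :=
              (9 / (8 * norm2 (betaVec β lam) * Real.sqrt p)) • kronRow p (betaVec β lam)
            ∀ x ∈ T, ∀ x' ∈ T,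
              |norm2 (Vt.mulVec (f x - f x')) - norm2 (x - x')|
                ≤ α * norm2 (x - x') + C₂ * β ^ (-(lam : ℤ) + 1))
          ≥ 1 - ρ - Real.exp (-ν) := by
  have hβ0 : 0 < β := by linarith
  have hβ' : 0 < β - 1 := by linarith
  set Γ := β / (β - 1) with hΓdef
  have hΓ : 0 < Γ := by positivity
  refine ⟨(8800 * Γ) ^ 2, 9 / 4, by positivity, by norm_num, ?_⟩
  intro n p lam U T α ρ ν k hn hp hlam hUU hU hT hα hα1 hρ hρ1 hν hk _ hpk
  classical
  have hn0 : 0 < n := by omega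
  have : Nonempty (Fin n) := ⟨⟨0, hn0⟩⟩
  rcases T.eq_empty_or_nonempty with rfl | hTne
  · refine le_of_le_of_eq (?_ : _ ≤ (1 : ℝ)) ?_
    · linarith [Real.exp_pos (-ν)]
    · rw [unifProb]
      simp only [Finset.notMem_empty, false_imp_iff, implies_true]
      rw [Nat.card_congr (Equiv.subtypeUnivEquiv fun _ => trivial), Nat.card_eq_fintype_card,
        div_self]
      exact_mod_cast Fintype.card_ne_zero
  have hN : 0 < T.card := Finset.card_pos.2 hTne
  have hN' : (1 : ℝ) ≤ T.card := by exact_mod_cast hN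
  have hlogN : 0 ≤ Real.log (8 * (T.card : ℝ)) := Real.log_nonneg (by linarith)
  have hk0 : (0 : ℝ) < k := by linarith
  have hk1 : 1 ≤ k := by exact_mod_cast hk0
  obtain ⟨D, hDcard, hD1, hDmem⟩ := exists_unit_differences T
  have hp' : (0 : ℝ) < p := by exact_mod_cast hp
  have hsp : 0 < Real.sqrt p := Real.sqrt_pos.2 hp'
  have hαρ : 0 < α * ρ := by positivity
  set κ := 4400 * Γ * Real.sqrt k * Real.log n ^ 2 / Real.sqrt p with hκ
  have hκαρ : 2 * κ ≤ α * ρ := by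
    have h1 : 8800 * Γ * Real.sqrt k * Real.log n ^ 2 / (α * ρ) ≤ Real.sqrt p := by
      refine Real.le_sqrt_of_sq_le (le_trans (le_of_eq ?_) hpk)
      rw [div_pow, mul_pow, mul_pow, Real.sq_sqrt hk0.le]
      ring
    rw [div_le_iff₀ hαρ] at h1
    have e : 2 * κ = 8800 * Γ * Real.sqrt k * Real.log n ^ 2 / Real.sqrt p := by
      rw [hκ]; ring
    rw [e, div_le_iff₀ hsp]
    linarith
  have hκ1 : κ ≤ 1 := by nlinarith
  refine unifProb_ge_of_conditional (sampleEquiv n p lam) _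
    (fun b => ∀ z ∈ D, Splits U (min (4 * (k : ℝ)) n) (Real.sqrt (2 * Real.log (4 * n)))
      (fun t => rsign (b t) * z t))
    (fun b y => ∀ z ∈ D, |(1 / p : ℝ) * ∑ i, (∑ t, condensedRow U (unitBetaVec β lam) (y i) t
      * (rsign (b t) * z t)) ^ 2 - 1| ≤ α) hρ.le
    (by convert card_exists_not_splits_le hn0 U hU D hN hDcard hD1 hν hk) ?_ ?_
  · intro b hb
    obtain ⟨δ, hδ0, hδ1, hδ2⟩ := exists_expect_deviation_le hn hp hk1 U hU
      (D.image fun z t => rsign (b t) * z t)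
      (by
        intro w hw
        obtain ⟨z, hz, rfl⟩ := Finset.mem_image.1 hw
        exact hb z hz)
      (by
        have h1 : ((D.image fun z t => rsign (b t) * z t).card : ℝ) ≤ (T.card : ℝ) ^ 2 := by
          exact_mod_cast Finset.card_image_le.trans hDcard
        have h2 : Real.exp (2 * Real.log (8 * (T.card : ℝ))) ≤ Real.exp k :=
          Real.exp_le_exp.2 (by linarith)
        rw [two_mul, Real.exp_add, Real.exp_log (by positivity)] at h2
        nlinarith)
      (condensedRow U (unitBetaVec β lam)) hΓ
      (fun y z M hM => abs_sum_condensedRow_mul_le U _ (unitBetaVec_nonneg hβ1 hlam)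
        (sum_unitBetaVec_le hβ1 hlam) y z M ((abs_nonneg _).trans (hM ⟨0, hn0⟩)) hM)
      (by
        intro w hw
        obtain ⟨z, hz, rfl⟩ := Finset.mem_image.1 hw
        rw [expect_sq_sum_condensedRow_mul hn0 U hUU _ (sum_sq_unitBetaVec hβ1 hlam)]
        simpa [mul_pow, rsign_sq] using hD1 z hz)
      hκ hκ1
    refine le_trans ?_ (card_lt_le_of_expect_le δ hδ0 hα (hδ2.trans hκαρ))
    refine Nat.cast_le.2 (Finset.card_le_card fun y hy => ?_)
    refine (@Finset.mem_filter_univ _ _ _ (_) _).2 fun hle => ?_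
    exact (@Finset.mem_filter_univ _ _ _ (_) _).1 hy fun z hz =>
      (hδ1 y _ (Finset.mem_image_of_mem _ hz)).trans hle
  · intro ω _ hE Φ Dd f Vt x hx x' hx'
    exact embedding_of_deviation hβ1 hβ2 hp hlam U hU ω.1 ω.2.1 ω.2.2 x x' (hT x hx) (hT x' hx')
      fun hxx => hE _ (hDmem x hx x' hx' hxx)
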